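/- Let n ≥ 5 and 1 < p < (n+4)/(n-4). There exists a constant C, depending only on n and p, such that every nonnegative C⁴ solution u of Δ²u = u^p in the exterior domain B₁^c = {x ∈ ℝⁿ : |x| > 1} satisfies u(x) ≤ C |x|^{-4/(p-1)} for all x with |x| > 2. -/

import Mathlib

open MeasureTheory Metric Filter

/-- The Euclidean Laplacian `Δu` of `u : ℝⁿ → ℝ`, computed as the trace of the second
derivative: `Δu(x) = ∑ i, ∂²u/∂xᵢ²(x)`. -/
noncomputable def lap {n : ℕ} (u : EuclideanSpace ℝ (Fin n) → ℝ) :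
    EuclideanSpace ℝ (Fin n) → ℝ :=
  fun x => ∑ i : Fin n,
    iteratedFDeriv ℝ 2 u x ![EuclideanSpace.single i 1, EuclideanSpace.single i 1]

/-- The biharmonic operator `Δ²u = Δ(Δu)`. -/
noncomputable def bilap {n : ℕ} (u : EuclideanSpace ℝ (Fin n) → ℝ) :
    EuclideanSpace ℝ (Fin n) → ℝ :=
  lap (lap u)

theorem lap_eq_sum_fderiv {n : ℕ} (u : EuclideanSpace ℝ (Fin n) → ℝ)
    (x : EuclideanSpace ℝ (Fin n)) :
    lap u x = ∑ i : Fin n,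
      fderiv ℝ (fderiv ℝ u) x (EuclideanSpace.single i 1) (EuclideanSpace.single i 1) := by
  simp [lap, iteratedFDeriv_two_apply]

theorem lap_congr_of_eventuallyEq {n : ℕ} {u v : EuclideanSpace ℝ (Fin n) → ℝ}
    {x : EuclideanSpace ℝ (Fin n)} (h : u =ᶠ[nhds x] v) : lap u =ᶠ[nhds x] lap v := by
  filter_upwards [h.eventuallyEq_nhds] with y hy
  simp only [lap_eq_sum_fderiv, (hy.fderiv (𝕜 := ℝ)).fderiv_eq]

theorem bilap_congr_of_eventuallyEq {n : ℕ} {u v : EuclideanSpace ℝ (Fin n) → ℝ}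
    {x : EuclideanSpace ℝ (Fin n)} (h : u =ᶠ[nhds x] v) : bilap u x = bilap v x :=
  (lap_congr_of_eventuallyEq (lap_congr_of_eventuallyEq h)).eq_of_nhds

theorem lap_comp_affine {n : ℕ} (u : EuclideanSpace ℝ (Fin n) → ℝ) (c r : ℝ)
    (a : EuclideanSpace ℝ (Fin n)) :
    lap (fun y => c * u (a + r • y)) = fun y => (c * r ^ 2) * lap u (a + r • y) := by
  have key : ∀ {F : Type} [NormedAddCommGroup F] [NormedSpace ℝ F] (w : EuclideanSpace ℝ (Fin n) → F) (c : ℝ),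
      fderiv ℝ (fun y => c • w (a + r • y)) = fun y => (c * r) • fderiv ℝ w (a + r • y) := by
    intro F _ _ w c
    ext1 y
    have h1 := congrFun (fderiv_const_smul_field (𝕜 := ℝ) (f := fun y => w (a + r • y)) c) y
    have h2 : fderiv ℝ (fun y => w (a + r • y)) y = r • fderiv ℝ w (a + r • y) := by
      rw [fderiv_comp_smul (f := fun z => w (a + z)), fderiv_comp_add_left]
    rw [mul_smul, ← h2]
    exact h1
  ext1 y
  simp only [lap_eq_sum_fderiv]
  have h1 := key u c
  simp only [smul_eq_mul] at h1
  rw [h1, key (fderiv ℝ u) (c * r), Finset.mul_sum]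
  refine Finset.sum_congr rfl fun i _ => ?_
  simp only [_root_.smul_apply, smul_eq_mul]
  ring

theorem bilap_comp_affine {n : ℕ} (u : EuclideanSpace ℝ (Fin n) → ℝ) (c r : ℝ)
    (a : EuclideanSpace ℝ (Fin n)) :
    bilap (fun y => c * u (a + r • y)) = fun y => (c * r ^ 4) * bilap u (a + r • y) := by
  ext1 y
  simp only [bilap, lap_comp_affine]
  ring

theorem ContDiffAt.lap {n : ℕ} {u : EuclideanSpace ℝ (Fin n) → ℝ} {k m : ℕ}
    {x : EuclideanSpace ℝ (Fin n)} (h : ContDiffAt ℝ k u x) (hm : m + 2 ≤ k) :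
    ContDiffAt ℝ m (lap u) x := by
  have h2 : ContDiffAt ℝ m (iteratedFDeriv ℝ 2 u) x :=
    h.iteratedFDeriv_right (by exact_mod_cast hm)
  unfold _root_.lap
  refine ContDiffAt.sum fun i _ => ?_
  exact (ContinuousMultilinearMap.apply ℝ (fun _ : Fin 2 => EuclideanSpace ℝ (Fin n)) ℝ
    ![EuclideanSpace.single i 1, EuclideanSpace.single i 1]).contDiff.contDiffAt.comp x h2

theorem ContDiff.lap {n : ℕ} {u : EuclideanSpace ℝ (Fin n) → ℝ} {k m : ℕ}
    (h : ContDiff ℝ k u) (hm : m + 2 ≤ k) : ContDiff ℝ m (lap u) :=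
  contDiff_iff_contDiffAt.2 fun _ => h.contDiffAt.lap hm

theorem HasCompactSupport.lap {n : ℕ} {u : EuclideanSpace ℝ (Fin n) → ℝ}
    (h : HasCompactSupport u) : HasCompactSupport (lap u) := by
  have h2 : HasCompactSupport (_root_.iteratedFDeriv ℝ 2 u) := h.iteratedFDeriv (𝕜 := ℝ) 2
  refine h2.mono fun x hx => ?_
  contrapose! hx
  simp only [Function.mem_support, ne_eq, not_not] at hx ⊢
  simp [_root_.lap, hx]

/-- Green's second identity without boundary terms. -/
theorem integral_mul_lap_eq {n : ℕ} {f g : EuclideanSpace ℝ (Fin n) → ℝ}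
    (hf : ContDiff ℝ 2 f) (hg : ContDiff ℝ 2 g) (hc : HasCompactSupport f) :
    ∫ x, f x * lap g x = ∫ x, lap f x * g x := by
  have e : ∀ (w : EuclideanSpace ℝ (Fin n) → ℝ), ContDiff ℝ 2 w → ∀ i x,
      fderiv ℝ (fderiv ℝ w) x (EuclideanSpace.single i 1) (EuclideanSpace.single i 1) =
      fderiv ℝ (fun z => fderiv ℝ w z (EuclideanSpace.single i 1)) x
        (EuclideanSpace.single i 1) := by
    intro w hw i x
    have : DifferentiableAt ℝ (fderiv ℝ w) x :=
      ((hw.fderiv_right (m := 1) (by norm_num)).differentiable (by norm_num)) x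
    rw [fderiv_clm_apply this (differentiableAt_const _)]
    simp
  have d1 : ∀ {w : EuclideanSpace ℝ (Fin n) → ℝ}, ContDiff ℝ 2 w → ∀ v,
      ContDiff ℝ 1 (fun z => fderiv ℝ w z v) := fun hw v =>
    (hw.fderiv_right (m := 1) (by norm_num)).clm_apply contDiff_const
  have c0 : ∀ v, HasCompactSupport (fun z => fderiv ℝ f z v) := fun v => hc.fderiv_apply (𝕜 := ℝ) v
  have hfd : Differentiable ℝ f := hf.differentiable (by norm_num)
  have hgd : Differentiable ℝ g := hg.differentiable (by norm_num)
  have c2 : ∀ {w : EuclideanSpace ℝ (Fin n) → ℝ}, ContDiff ℝ 2 w → ∀ v,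
      Continuous (fun x => fderiv ℝ (fun z => fderiv ℝ w z v) x v) := fun hw v =>
    ((d1 hw v).continuous_fderiv (by norm_num)).clm_apply continuous_const
  have main : ∀ v, ∫ x, f x * fderiv ℝ (fun z => fderiv ℝ g z v) x v =
      ∫ x, fderiv ℝ (fun z => fderiv ℝ f z v) x v * g x := by
    intro v
    have hfv := c0 v
    have hff : HasCompactSupport (fun x => fderiv ℝ (fun z => fderiv ℝ f z v) x v) :=
      hfv.fderiv_apply (𝕜 := ℝ) v
    have i1 : Integrable (fun x => fderiv ℝ f x v * fderiv ℝ g x v) :=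
      ((d1 hf v).continuous.mul (d1 hg v).continuous).integrable_of_hasCompactSupport hfv.mul_right
    rw [integral_mul_fderiv_eq_neg_fderiv_mul_of_integrable i1
      ((hf.continuous.mul (c2 hg v)).integrable_of_hasCompactSupport hc.mul_right)
      ((hf.continuous.mul (d1 hg v).continuous).integrable_of_hasCompactSupport hc.mul_right)
      (fun x _ => hfd x) (fun x _ => ((d1 hg v).differentiable (by norm_num)) x)]
    rw [integral_mul_fderiv_eq_neg_fderiv_mul_of_integrable
      (((c2 hf v).mul hg.continuous).integrable_of_hasCompactSupport hff.mul_right) i1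
      (((d1 hf v).continuous.mul hg.continuous).integrable_of_hasCompactSupport hfv.mul_right)
      (fun x _ => ((d1 hf v).differentiable (by norm_num)) x) (fun x _ => hgd x)]
    simp
  simp only [lap_eq_sum_fderiv, e f hf, e g hg, Finset.mul_sum, Finset.sum_mul]
  rw [integral_finsetSum, integral_finsetSum]
  · exact Finset.sum_congr rfl fun i _ => main _
  · intro i _
    have hff : HasCompactSupport (fun x => fderiv ℝ (fun z => fderiv ℝ f z
        (EuclideanSpace.single i 1)) x (EuclideanSpace.single i 1)) :=
      (c0 _).fderiv_apply (𝕜 := ℝ) _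
    exact ((c2 hf _).mul hg.continuous).integrable_of_hasCompactSupport hff.mul_right
  · intro i _
    exact (hf.continuous.mul (c2 hg _)).integrable_of_hasCompactSupport hc.mul_right

theorem integral_mul_bilap_eq {n : ℕ} {f g : EuclideanSpace ℝ (Fin n) → ℝ}
    (hf : ContDiff ℝ 4 f) (hg : ContDiff ℝ 4 g) (hc : HasCompactSupport f) :
    ∫ x, f x * bilap g x = ∫ x, bilap f x * g x := by
  have h2 : ∀ {w : EuclideanSpace ℝ (Fin n) → ℝ}, ContDiff ℝ 4 w → ContDiff ℝ 2 w :=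
    fun h => h.of_le (by norm_num)
  have h3 : ∀ {w : EuclideanSpace ℝ (Fin n) → ℝ}, ContDiff ℝ 4 w → ContDiff ℝ 2 (lap w) :=
    fun h => ContDiff.lap (k := 4) (m := 2) h (by norm_num)
  unfold bilap
  rw [integral_mul_lap_eq (h2 hf) (h3 hg) hc, integral_mul_lap_eq (h3 hf) (h2 hg) hc.lap]

/-- `4 t h''(t) + 2 n h'(t)`, so that `Δ(h(|y|²)) = (radLap n h)(|y|²)`. -/
noncomputable def radLap (n : ℕ) (h : ℝ → ℝ) (t : ℝ) : ℝ :=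
  4 * t * deriv (deriv h) t + 2 * n * deriv h t

theorem lap_radial {n : ℕ} {h : ℝ → ℝ} {d : ℝ} {x : EuclideanSpace ℝ (Fin n)}
    {s : Set ℝ} (hs : IsOpen s) (hh : ContDiffOn ℝ 2 h s) (hx : ‖x‖ ^ 2 + d ∈ s) :
    lap (fun y => h (‖y‖ ^ 2 + d)) x =
      radLap n h (‖x‖ ^ 2 + d) - 4 * d * deriv (deriv h) (‖x‖ ^ 2 + d) := by
  have ht : ∀ z : EuclideanSpace ℝ (Fin n),
      HasFDerivAt (fun y : EuclideanSpace ℝ (Fin n) => ‖y‖ ^ 2 + d) ((2 : ℝ) • innerSL ℝ z) z :=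
    fun z => by
      have := (hasStrictFDerivAt_norm_sq z).hasFDerivAt.add_const d
      rwa [← Nat.cast_smul_eq_nsmul ℝ] at this
  have hcont : ContinuousAt (fun y : EuclideanSpace ℝ (Fin n) => ‖y‖ ^ 2 + d) x :=
    (ht x).continuousAt
  have hnear : ∀ᶠ s in nhds (‖x‖ ^ 2 + d), ContDiffAt ℝ 2 h s :=
    (hs.eventually_mem hx).mono fun s h => hh.contDiffAt (hs.mem_nhds h)
  have h1 : fderiv ℝ (fun y : EuclideanSpace ℝ (Fin n) => h (‖y‖ ^ 2 + d)) =ᶠ[nhds x]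
      fun z => deriv h (‖z‖ ^ 2 + d) • ((2 : ℝ) • innerSL ℝ z) := by
    filter_upwards [hcont.eventually hnear] with z hz
    exact ((hz.differentiableAt (by norm_num)).hasDerivAt.comp_hasFDerivAt z (ht z)).fderiv
  have h2 : HasDerivAt (deriv h) (deriv (deriv h) (‖x‖ ^ 2 + d)) (‖x‖ ^ 2 + d) :=
    (((hh.deriv_of_isOpen (m := 1) hs (by norm_num)).contDiffAt (hs.mem_nhds hx)).differentiableAt
      (by norm_num)).hasDerivAt
  have h3 : HasFDerivAt (fun z : EuclideanSpace ℝ (Fin n) => (2 : ℝ) • innerSL ℝ z)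
      ((2 : ℝ) • innerSL ℝ) x := ((2 : ℝ) • innerSL ℝ (E := EuclideanSpace ℝ (Fin n))).hasFDerivAt
  have h5 : HasFDerivAt (fun z : EuclideanSpace ℝ (Fin n) => deriv h (‖z‖ ^ 2 + d))
      (deriv (deriv h) (‖x‖ ^ 2 + d) • ((2 : ℝ) • innerSL ℝ x)) x :=
    (h2.comp_hasFDerivAt x (ht x) :)
  have h4 : HasFDerivAt (fun z : EuclideanSpace ℝ (Fin n) =>
      deriv h (‖z‖ ^ 2 + d) • ((2 : ℝ) • innerSL ℝ z)) _ x := h5.smul h3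
  rw [lap_eq_sum_fderiv, h1.fderiv_eq, h4.fderiv]
  have hn : ‖x‖ ^ 2 = ∑ i, x i ^ 2 := EuclideanSpace.real_norm_sq_eq x
  have h7 : ∀ i : Fin n, innerSL ℝ (EuclideanSpace.single i (1 : ℝ))
      (EuclideanSpace.single i (1 : ℝ)) = 1 := fun i => by
    rw [innerSL_apply_apply, EuclideanSpace.inner_single_right]; simp
  simp only [radLap]
  clear h1 h4 h5 h2 hnear hcont hx
  generalize deriv (deriv h) (‖x‖ ^ 2 + d) = p
  have h6 : ∑ i, p * (2 * x i) * (2 * x i) = 4 * p * ‖x‖ ^ 2 := by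
    rw [hn, Finset.mul_sum]
    exact Finset.sum_congr rfl fun i _ => by ring
  have h8 : ∀ i : Fin n, inner ℝ x (EuclideanSpace.single i (1 : ℝ)) = x i := fun i => by
    rw [EuclideanSpace.inner_single_right]; simp
  simp [Finset.sum_add_distrib, h7, h8, h6]
  ring

theorem radLap_contDiffOn {n : ℕ} {h : ℝ → ℝ} (hh : ContDiffOn ℝ (⊤ : ℕ∞) h (Set.Ioi 0)) :
    ContDiffOn ℝ (⊤ : ℕ∞) (radLap n h) (Set.Ioi 0) := by
  have h1 : ContDiffOn ℝ (⊤ : ℕ∞) (deriv h) (Set.Ioi 0) := hh.deriv_of_isOpen isOpen_Ioi (by simp)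
  have h2 : ContDiffOn ℝ (⊤ : ℕ∞) (deriv (deriv h)) (Set.Ioi 0) :=
    h1.deriv_of_isOpen isOpen_Ioi (by simp)
  exact ((contDiffOn_const.mul contDiffOn_id).mul h2).add (contDiffOn_const.mul h1)

theorem bilap_radial {n : ℕ} {h : ℝ → ℝ} (hh : ContDiffOn ℝ (⊤ : ℕ∞) h (Set.Ioi 0)) {d : ℝ}
    (hd : 0 < d) (x : EuclideanSpace ℝ (Fin n)) :
    bilap (fun y => h (‖y‖ ^ 2 + d)) x =
      radLap n (radLap n h) (‖x‖ ^ 2 + d)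
      + d * (-4 * (radLap n (deriv (deriv h)) (‖x‖ ^ 2 + d)
          + deriv (deriv (radLap n h)) (‖x‖ ^ 2 + d)))
      + d ^ 2 * (16 * deriv (deriv (deriv (deriv h))) (‖x‖ ^ 2 + d)) := by
  have D : ∀ {g : ℝ → ℝ}, ContDiffOn ℝ (⊤ : ℕ∞) g (Set.Ioi 0) →
      ContDiffOn ℝ (⊤ : ℕ∞) (deriv g) (Set.Ioi 0) :=
    fun hg => hg.deriv_of_isOpen isOpen_Ioi (by simp)
  have hpos : ∀ y : EuclideanSpace ℝ (Fin n), ‖y‖ ^ 2 + d ∈ Set.Ioi (0 : ℝ) := fun y => by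
    rw [Set.mem_Ioi]; positivity
  have hle : (2 : WithTop ℕ∞) ≤ ((⊤ : ℕ∞) : WithTop ℕ∞) :=
    WithTop.coe_le_coe.2 (le_top : (2 : ℕ∞) ≤ ⊤)
  have diff : ∀ {g : ℝ → ℝ}, ContDiffOn ℝ (⊤ : ℕ∞) g (Set.Ioi 0) → ∀ t ∈ Set.Ioi (0 : ℝ),
      DifferentiableAt ℝ g t := fun hg t ht =>
    ((hg.contDiffAt (isOpen_Ioi.mem_nhds ht)).differentiableAt (by simp))
  set g : ℝ → ℝ := fun t => radLap n h t - 4 * d * deriv (deriv h) t with hg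
  have hgs : ContDiffOn ℝ (⊤ : ℕ∞) g (Set.Ioi 0) :=
    (radLap_contDiffOn hh).sub (contDiffOn_const.mul (D (D hh)))
  have h1 : lap (fun y : EuclideanSpace ℝ (Fin n) => h (‖y‖ ^ 2 + d)) =
      fun y => g (‖y‖ ^ 2 + d) := by
    ext1 y
    exact lap_radial isOpen_Ioi (hh.of_le hle) (hpos y)
  have g1 : Set.EqOn (deriv g) (fun t => deriv (radLap n h) t - 4 * d * deriv (deriv (deriv h)) t)
      (Set.Ioi 0) := by
    intro t ht
    have := ((diff (radLap_contDiffOn (n := n) hh) t ht).hasDerivAt.sub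
      ((diff (D (D hh)) t ht).hasDerivAt.const_mul (4 * d))).deriv
    exact this
  have g2 : Set.EqOn (deriv (deriv g)) (fun t => deriv (deriv (radLap n h)) t
      - 4 * d * deriv (deriv (deriv (deriv h))) t) (Set.Ioi 0) := by
    intro t ht
    rw [(g1.eventuallyEq_of_mem (isOpen_Ioi.mem_nhds ht)).deriv_eq]
    exact ((diff (D (radLap_contDiffOn (n := n) hh)) t ht).hasDerivAt.sub
      ((diff (D (D (D hh))) t ht).hasDerivAt.const_mul (4 * d))).deriv
  rw [bilap, h1, lap_radial isOpen_Ioi (hgs.of_le hle) (hpos x), g2 (hpos x)]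
  have e : radLap n g (‖x‖ ^ 2 + d) = radLap n (radLap n h) (‖x‖ ^ 2 + d)
      - 4 * d * radLap n (deriv (deriv h)) (‖x‖ ^ 2 + d) := by
    simp only [radLap, g1 (hpos x), g2 (hpos x)]
    ring
  rw [e]
  ring

theorem deriv_eqOn_rpow {f : ℝ → ℝ} {c b : ℝ}
    (h : Set.EqOn f (fun t => c * t ^ b) (Set.Ioo 0 (1 / 2))) :
    Set.EqOn (deriv f) (fun t => (c * b) * t ^ (b - 1)) (Set.Ioo 0 (1 / 2)) := by
  intro t ht
  rw [(h.eventuallyEq_of_mem (isOpen_Ioo.mem_nhds ht)).deriv_eq]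
  rw [((Real.hasDerivAt_rpow_const (Or.inl ht.1.ne')).const_mul c).deriv]
  ring

theorem radLap_eqOn_rpow {n : ℕ} {f : ℝ → ℝ} {c b : ℝ}
    (h : Set.EqOn f (fun t => c * t ^ b) (Set.Ioo 0 (1 / 2))) :
    Set.EqOn (radLap n f) (fun t => (c * b * (4 * (b - 1) + 2 * n)) * t ^ (b - 1))
      (Set.Ioo 0 (1 / 2)) := by
  intro t ht
  have h1 := deriv_eqOn_rpow h
  simp only [radLap, h1 ht, deriv_eqOn_rpow h1 ht]
  rw [Real.rpow_sub_one ht.1.ne' (b - 1)]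
  field_simp [ht.1.ne']

/-- A compactly supported modification of `t ^ ((4 - n) / 2)`. -/
noncomputable def cutProfile (n : ℕ) (t : ℝ) : ℝ :=
  t ^ ((4 - n : ℝ) / 2) * Real.smoothTransition (3 - 4 * t)

theorem cutProfile_contDiffOn (n : ℕ) :
    ContDiffOn ℝ (⊤ : ℕ∞) (cutProfile n) (Set.Ioi 0) := by
  refine ContDiffOn.mul ?_ ?_
  · intro t ht
    exact (Real.contDiffAt_rpow_const_of_ne (ne_of_gt ht)).contDiffWithinAt
  · exact (Real.smoothTransition.contDiff.comp
      (contDiff_const.sub (contDiff_const.mul contDiff_id))).contDiffOn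

theorem cutProfile_eq {n : ℕ} {t : ℝ} (ht : t ≤ 1 / 2) :
    cutProfile n t = t ^ ((4 - n : ℝ) / 2) := by
  rw [cutProfile, Real.smoothTransition.one_of_one_le (by linarith), mul_one]

theorem cutProfile_eq_zero {n : ℕ} {t : ℝ} (ht : 3 / 4 ≤ t) : cutProfile n t = 0 := by
  rw [cutProfile, Real.smoothTransition.zero_of_nonpos (by linarith), mul_zero]

theorem cutProfile_nonneg {n : ℕ} {t : ℝ} (ht : 0 ≤ t) : 0 ≤ cutProfile n t :=
  mul_nonneg (Real.rpow_nonneg ht _) (Real.smoothTransition.nonneg _)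

theorem cutProfile_le {n : ℕ} {t : ℝ} (ht : 0 ≤ t) :
    cutProfile n t ≤ t ^ ((4 - n : ℝ) / 2) :=
  mul_le_of_le_one_right (Real.rpow_nonneg ht _) (Real.smoothTransition.le_one _)

theorem exists_bounded_continuous_extension {f : ℝ → ℝ} (hf : ContinuousOn f (Set.Ioi 0))
    (h0 : Set.EqOn f 0 (Set.Ioi (3 / 4))) :
    ∃ g : ℝ → ℝ, Continuous g ∧ (∃ B, ∀ t, |g t| ≤ B) ∧ Set.EqOn g f (Set.Ici (1 / 2)) := by
  have hc : Continuous fun t => f (max t (1 / 2)) :=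
    hf.comp_continuous (by fun_prop) fun t =>
      lt_of_lt_of_le (by norm_num : (0 : ℝ) < 1 / 2) (le_max_right t _)
  obtain ⟨B, hB⟩ := (isCompact_Icc (a := (0 : ℝ)) (b := 1)).exists_bound_of_continuousOn
    hc.continuousOn
  refine ⟨fun t => f (max t (1 / 2)), hc, ⟨B, fun t => ?_⟩, fun t ht => ?_⟩
  · have hB0 : 0 ≤ B := (norm_nonneg _).trans (hB 0 (by simp))
    rcases le_or_gt t 0 with h | h
    · have := hB 0 (by simp)
      rwa [max_eq_right (by norm_num : (0 : ℝ) ≤ 1 / 2),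
        ← max_eq_right (h.trans (by norm_num) : t ≤ 1 / 2)] at this
    · rcases le_or_gt t 1 with h1 | h1
      · exact hB t ⟨h.le, h1⟩
      · have : f (max t (1 / 2)) = 0 :=
          h0 (lt_of_lt_of_le (by linarith : (3 : ℝ) / 4 < t) (le_max_left _ _))
        show |f (max t (1 / 2))| ≤ B
        rw [this, abs_zero]
        exact hB0
  · simp only
    rw [max_eq_left ht]

theorem bilap_cutProfile (n : ℕ) : ∃ A₀ A₁ A₂ : ℝ → ℝ, ∃ B : ℝ,
    Continuous A₀ ∧ Continuous A₁ ∧ Continuous A₂ ∧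
    (∀ t, |A₀ t| ≤ B) ∧ (∀ t, |A₁ t| ≤ B) ∧ (∀ t, |A₂ t| ≤ B) ∧ (∀ t, 1 ≤ t → A₀ t = 0) ∧
    ∀ d : ℝ, 0 < d → ∀ y : EuclideanSpace ℝ (Fin n),
      bilap (fun y => cutProfile n (‖y‖ ^ 2 + d)) y =
        if ‖y‖ ^ 2 + d < 1 / 2 then
          ((n - 4 : ℝ) * (n - 2) * n * (n + 2)) * (d ^ 2 *
            (‖y‖ ^ 2 + d) ^ (-((n : ℝ) + 4) / 2))
        else A₀ (‖y‖ ^ 2 + d) + d * A₁ (‖y‖ ^ 2 + d) + d ^ 2 * A₂ (‖y‖ ^ 2 + d) := by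
  set h := cutProfile n with hh
  have hs : ContDiffOn ℝ (⊤ : ℕ∞) h (Set.Ioi 0) := cutProfile_contDiffOn n
  have D : ∀ {g : ℝ → ℝ}, ContDiffOn ℝ (⊤ : ℕ∞) g (Set.Ioi 0) →
      ContDiffOn ℝ (⊤ : ℕ∞) (deriv g) (Set.Ioi 0) :=
    fun hg => hg.deriv_of_isOpen isOpen_Ioi (by simp)
  have Z : ∀ {g : ℝ → ℝ}, Set.EqOn g 0 (Set.Ioi (3 / 4)) →
      Set.EqOn (deriv g) 0 (Set.Ioi (3 / 4)) := fun hg t ht => by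
    rw [(hg.eventuallyEq_of_mem (isOpen_Ioi.mem_nhds ht)).deriv_eq]; simp
  have ZL : ∀ {g : ℝ → ℝ}, Set.EqOn g 0 (Set.Ioi (3 / 4)) →
      Set.EqOn (radLap n g) 0 (Set.Ioi (3 / 4)) := fun hg t ht => by
    simp [radLap, Z hg ht, Z (Z hg) ht]
  have z : Set.EqOn h 0 (Set.Ioi (3 / 4)) := fun t ht => cutProfile_eq_zero (le_of_lt ht)
  obtain ⟨A₀, c0, ⟨B0, b0⟩, e0⟩ := exists_bounded_continuous_extension
    (radLap_contDiffOn (n := n) (radLap_contDiffOn (n := n) hs)).continuousOn (ZL (ZL z))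
  obtain ⟨A₁, c1, ⟨B1, b1⟩, e1⟩ := exists_bounded_continuous_extension
    (f := fun t => -4 * (radLap n (deriv (deriv h)) t + deriv (deriv (radLap n h)) t))
    (continuousOn_const.mul ((radLap_contDiffOn (n := n) (D (D hs))).continuousOn.add
      (D (D (radLap_contDiffOn (n := n) hs))).continuousOn))
    (fun t ht => by simp [ZL (Z (Z z)) ht, Z (Z (ZL z)) ht])
  obtain ⟨A₂, c2, ⟨B2, b2⟩, e2⟩ := exists_bounded_continuous_extension
    (f := fun t => 16 * deriv (deriv (deriv (deriv h))) t)
    (continuousOn_const.mul (D (D (D (D hs)))).continuousOn)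
    (fun t ht => by simp [Z (Z (Z (Z z))) ht])
  refine ⟨A₀, A₁, A₂, max B0 (max B1 B2), c0, c1, c2, fun t => (b0 t).trans (le_max_left _ _),
    fun t => (b1 t).trans ((le_max_left _ _).trans (le_max_right _ _)),
    fun t => (b2 t).trans ((le_max_right _ _).trans (le_max_right _ _)), fun t ht => ?_,
    fun d hd y => ?_⟩
  · rw [e0 (by simp only [Set.mem_Ici]; linarith)]
    exact ZL (ZL z) (by simp only [Set.mem_Ioi]; linarith)
  rw [bilap_radial hs hd]
  have hpos : 0 < ‖y‖ ^ 2 + d := by positivity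
  generalize ‖y‖ ^ 2 + d = t at hpos
  split_ifs with ht
  · have hm : t ∈ Set.Ioo (0 : ℝ) (1 / 2) := ⟨hpos, ht⟩
    have p0 : Set.EqOn h (fun t => 1 * t ^ ((4 - n : ℝ) / 2)) (Set.Ioo 0 (1 / 2)) :=
      fun t ht => by simpa [hh] using cutProfile_eq (n := n) ht.2.le
    rw [radLap_eqOn_rpow (radLap_eqOn_rpow p0) hm,
      radLap_eqOn_rpow (deriv_eqOn_rpow (deriv_eqOn_rpow p0)) hm,
      deriv_eqOn_rpow (deriv_eqOn_rpow (radLap_eqOn_rpow (n := n) p0)) hm,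
      deriv_eqOn_rpow (deriv_eqOn_rpow (deriv_eqOn_rpow (deriv_eqOn_rpow p0))) hm]
    have x1 : (4 - n : ℝ) / 2 - 1 - 1 - 1 - 1 = -((n : ℝ) + 4) / 2 := by ring
    simp only [x1]
    ring
  · have hm : t ∈ Set.Ici (1 / 2 : ℝ) := not_lt.1 ht
    rw [e0 hm, e1 hm, e2 hm]

theorem integrableOn_ball_rpow_norm {n : ℕ} (hn : 5 ≤ n) (r : ℝ) :
    IntegrableOn (fun y : EuclideanSpace ℝ (Fin n) => ‖y‖ ^ (4 - n : ℝ)) (ball 0 r) := by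
  have hd : Module.finrank ℝ (EuclideanSpace ℝ (Fin n)) = n := by simp
  have hn' : (5 : ℝ) ≤ n := by exact_mod_cast hn
  refine integrableOn_ball_of_norm_le_rpow (C := 1) (α := n - 4) (by omega) ?_ ?_ ?_
  · rw [hd]; linarith
  · refine ae_of_all _ fun x => ?_
    rw [Real.norm_of_nonneg (Real.rpow_nonneg (norm_nonneg _) _), one_mul, neg_sub]
  · exact (measurable_norm.pow_const _).aestronglyMeasurable

theorem norm_sq_rpow_half (n : ℕ) {x : ℝ} (hx : 0 ≤ x) :
    (x ^ 2) ^ ((4 - n : ℝ) / 2) = x ^ (4 - n : ℝ) := by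
  rw [← Real.rpow_natCast, ← Real.rpow_mul hx]
  congr 1
  push_cast
  ring

theorem tendsto_integral_cutProfile {n : ℕ} (hn : 5 ≤ n) {g : EuclideanSpace ℝ (Fin n) → ℝ}
    (hg : Continuous g) (hc : HasCompactSupport g) :
    Tendsto (fun e : ℝ => ∫ y, cutProfile n (‖y‖ ^ 2 + e ^ 2) * g y) (nhdsWithin 0 (Set.Ioi 0))
      (nhds (∫ y, cutProfile n (‖y‖ ^ 2) * g y)) := by
  have hn' : (5 : ℝ) ≤ n := by exact_mod_cast hn
  obtain ⟨M, hM⟩ := hc.exists_bound_of_continuous hg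
  have hM0 : 0 ≤ M := (norm_nonneg _).trans (hM 0)
  have : Nontrivial (EuclideanSpace ℝ (Fin n)) :=
    Module.nontrivial_of_finrank_pos (R := ℝ) (by simp; omega)
  refine tendsto_integral_filter_of_dominated_convergence
    ((ball 0 1).indicator fun y => M * ‖y‖ ^ (4 - n : ℝ)) ?_ ?_ ?_ ?_
  · filter_upwards [self_mem_nhdsWithin] with e he
    refine (Continuous.mul ?_ hg).aestronglyMeasurable
    refine (cutProfile_contDiffOn n).continuousOn.comp_continuous (by fun_prop) fun y => ?_
    have : 0 < e := he
    rw [Set.mem_Ioi]; positivity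
  · filter_upwards [self_mem_nhdsWithin] with e he
    have hy0 : ∀ᵐ y : EuclideanSpace ℝ (Fin n), y ≠ 0 := by
      simp [ae_iff]
    filter_upwards [hy0] with y hy
    have : 0 < e := he
    have hp : 0 ≤ ‖y‖ ^ 2 + e ^ 2 := by positivity
    have hyp : 0 < ‖y‖ := norm_pos_iff.2 hy
    by_cases hb : y ∈ ball (0 : EuclideanSpace ℝ (Fin n)) 1
    · rw [Set.indicator_of_mem hb, norm_mul, Real.norm_of_nonneg (cutProfile_nonneg hp), mul_comm]
      refine mul_le_mul (hM y) ?_ (cutProfile_nonneg hp) hM0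
      refine (cutProfile_le hp).trans ?_
      rw [← norm_sq_rpow_half n (norm_nonneg y)]
      exact Real.rpow_le_rpow_of_nonpos (by positivity) (by nlinarith) (by linarith)
    · rw [Set.indicator_of_notMem hb, cutProfile_eq_zero, zero_mul, norm_zero]
      have : 1 ≤ ‖y‖ := by simpa using hb
      nlinarith
  · exact IntegrableOn.integrable_indicator ((integrableOn_ball_rpow_norm hn 1).const_mul M)
      measurableSet_ball
  · have hy0 : ∀ᵐ y : EuclideanSpace ℝ (Fin n), y ≠ 0 := by
      simp [ae_iff]
    filter_upwards [hy0] with y hy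
    have hyp : 0 < ‖y‖ := norm_pos_iff.2 hy
    refine Tendsto.mul_const _ ?_
    have h1 : ContinuousAt (cutProfile n) (‖y‖ ^ 2) :=
      (cutProfile_contDiffOn n).continuousOn.continuousAt (isOpen_Ioi.mem_nhds (by
        rw [Set.mem_Ioi]; positivity))
    refine h1.tendsto.comp ?_
    have h2 : Tendsto (fun e : ℝ => ‖y‖ ^ 2 + e ^ 2) (nhds 0) (nhds (‖y‖ ^ 2 + 0 ^ 2)) :=
      Continuous.tendsto (by fun_prop) 0
    rw [zero_pow two_ne_zero, add_zero] at h2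
    exact h2.mono_left nhdsWithin_le_nhds

theorem integrable_bubble (n : ℕ) :
    Integrable fun y : EuclideanSpace ℝ (Fin n) => (1 + ‖y‖ ^ 2) ^ (-((n : ℝ) + 4) / 2) :=
  integrable_rpow_neg_one_add_norm_sq (by simp)

/-- The rescaled bubbles `ε⁴ (|y|² + ε²)^{-(n+4)/2}` form an approximate identity. -/
theorem tendsto_integral_bubble {n : ℕ} {g : EuclideanSpace ℝ (Fin n) → ℝ}
    (hg : Continuous g) (hc : HasCompactSupport g) :
    Tendsto (fun e : ℝ => ∫ y, ((e ^ 2) ^ 2 * (‖y‖ ^ 2 + e ^ 2) ^ (-((n : ℝ) + 4) / 2)) * g y)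
      (nhdsWithin 0 (Set.Ioi 0))
      (nhds ((∫ y : EuclideanSpace ℝ (Fin n), (1 + ‖y‖ ^ 2) ^ (-((n : ℝ) + 4) / 2)) * g 0)) := by
  obtain ⟨M, hM⟩ := hc.exists_bound_of_continuous hg
  have h1 : ∀ e : ℝ, 0 < e →
      ∫ y, ((e ^ 2) ^ 2 * (‖y‖ ^ 2 + e ^ 2) ^ (-((n : ℝ) + 4) / 2)) * g y =
      ∫ y : EuclideanSpace ℝ (Fin n), (1 + ‖y‖ ^ 2) ^ (-((n : ℝ) + 4) / 2) * g (e • y) := by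
    intro e he
    have := Measure.integral_comp_smul (volume : Measure (EuclideanSpace ℝ (Fin n)))
      (fun y => ((e ^ 2) ^ 2 * (‖y‖ ^ 2 + e ^ 2) ^ (-((n : ℝ) + 4) / 2)) * g y) e
    rw [abs_of_pos (by positivity), smul_eq_mul, inv_mul_eq_div, eq_div_iff (by positivity)] at this
    rw [← this, mul_comm, ← integral_const_mul]
    refine integral_congr_ae (ae_of_all _ fun y => ?_)
    simp only [finrank_euclideanSpace, Fintype.card_fin, norm_smul, Real.norm_of_nonneg he.le]
    have e1 : (e * ‖y‖) ^ 2 + e ^ 2 = e ^ 2 * (1 + ‖y‖ ^ 2) := by ring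
    have e2 : (e ^ 2) ^ (-((n : ℝ) + 4) / 2) = (e ^ (n + 4))⁻¹ := by
      rw [← Real.rpow_natCast, ← Real.rpow_mul he.le, ← Real.rpow_natCast, ← Real.rpow_neg he.le]
      congr 1
      push_cast
      ring
    rw [e1, Real.mul_rpow (by positivity) (by positivity), e2, pow_add]
    field_simp
  have h2 : Tendsto (fun e : ℝ => ∫ y : EuclideanSpace ℝ (Fin n),
      (1 + ‖y‖ ^ 2) ^ (-((n : ℝ) + 4) / 2) * g (e • y)) (nhdsWithin 0 (Set.Ioi 0))
      (nhds (∫ y : EuclideanSpace ℝ (Fin n), (1 + ‖y‖ ^ 2) ^ (-((n : ℝ) + 4) / 2) * g 0)) := by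
    refine tendsto_integral_filter_of_dominated_convergence
      (fun y => M * (1 + ‖y‖ ^ 2) ^ (-((n : ℝ) + 4) / 2)) ?_ ?_ ((integrable_bubble n).const_mul M) ?_
    · exact Eventually.of_forall fun e =>
        (integrable_bubble n).aestronglyMeasurable.mul
          (hg.comp (continuous_const_smul e)).aestronglyMeasurable
    · refine Eventually.of_forall fun e => ae_of_all _ fun y => ?_
      rw [norm_mul, Real.norm_of_nonneg (by positivity), mul_comm]
      exact mul_le_mul_of_nonneg_right (hM _) (by positivity)
    · refine ae_of_all _ fun y => Tendsto.const_mul _ ?_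
      have : Tendsto (fun e : ℝ => g (e • y)) (nhds 0) (nhds (g ((0 : ℝ) • y))) :=
        Continuous.tendsto (by fun_prop) 0
      rw [zero_smul] at this
      exact this.mono_left nhdsWithin_le_nhds
  rw [integral_mul_const] at h2
  refine h2.congr' ?_
  filter_upwards [self_mem_nhdsWithin] with e he using (h1 e he).symm

theorem integral_cutProfile_mul_bilap {n : ℕ} (hn : 5 ≤ n) :
    ∃ k : EuclideanSpace ℝ (Fin n) → ℝ, ∃ B : ℝ, Measurable k ∧ (∀ y, |k y| ≤ B) ∧
      (∀ y, 1 ≤ ‖y‖ → k y = 0) ∧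
      ∀ w : EuclideanSpace ℝ (Fin n) → ℝ, ContDiff ℝ 4 w → HasCompactSupport w →
        ∫ y, cutProfile n (‖y‖ ^ 2) * bilap w y =
          ((n - 4 : ℝ) * (n - 2) * n * (n + 2)) *
            (∫ y : EuclideanSpace ℝ (Fin n), (1 + ‖y‖ ^ 2) ^ (-((n : ℝ) + 4) / 2)) * w 0 +
          ∫ y, k y * w y := by
  obtain ⟨A₀, A₁, A₂, B, c0, c1, c2, b0, b1, b2, z0, hb⟩ := bilap_cutProfile n
  have hB0 : 0 ≤ B := (abs_nonneg _).trans (b0 0)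
  have hn' : (5 : ℝ) ≤ n := by exact_mod_cast hn
  set c : ℝ := (n - 4 : ℝ) * (n - 2) * n * (n + 2) with hc
  have hc0 : 0 ≤ c := by
    have h1 : (0 : ℝ) ≤ n - 4 := by linarith
    have h2 : (0 : ℝ) ≤ n - 2 := by linarith
    positivity
  have mA : Measurable fun y : EuclideanSpace ℝ (Fin n) => A₀ (‖y‖ ^ 2) :=
    (c0.comp (by fun_prop)).measurable
  refine ⟨fun y => if ‖y‖ ^ 2 < 1 / 2 then 0 else A₀ (‖y‖ ^ 2), B, ?_, fun y => ?_,
    fun y hy => ?_, fun w hw hwc => ?_⟩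
  · exact Measurable.ite (measurableSet_lt (by fun_prop) measurable_const) measurable_const mA
  · dsimp only
    split_ifs
    · simpa using hB0
    · exact b0 _
  · have h1 : 1 ≤ ‖y‖ ^ 2 := one_le_pow₀ hy
    simp only
    rw [if_neg (by linarith), z0 _ h1]
  set F : ℝ → EuclideanSpace ℝ (Fin n) → ℝ := fun e y => cutProfile n (‖y‖ ^ 2 + e ^ 2) with hF
  set G : ℝ → EuclideanSpace ℝ (Fin n) → ℝ := fun e y =>
    (e ^ 2) ^ 2 * (‖y‖ ^ 2 + e ^ 2) ^ (-((n : ℝ) + 4) / 2) with hG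
  have hFs : ∀ e, 0 < e → ContDiff ℝ 4 (F e) := fun e he => by
    rw [← contDiffOn_univ]
    refine (contDiffOn_infty.1 (cutProfile_contDiffOn n) 4).comp (t := Set.Ioi 0)
      (f := fun y : EuclideanSpace ℝ (Fin n) => ‖y‖ ^ 2 + e ^ 2) ?_ ?_
    · exact ((contDiff_norm_sq ℝ).add contDiff_const).contDiffOn
    · intro y _
      rw [Set.mem_Ioi]; positivity
  have hFc : ∀ e, 0 < e → HasCompactSupport (F e) := fun e he =>
    HasCompactSupport.intro (isCompact_closedBall 0 1) fun y hy => by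
      have : 1 ≤ ‖y‖ := by
        simp only [mem_closedBall, dist_zero_right, not_le] at hy
        exact hy.le
      exact cutProfile_eq_zero (by nlinarith [sq_nonneg e])
  have hGc : ∀ e, 0 < e → Continuous (G e) := fun e he => by
    refine continuous_const.mul (Continuous.rpow_const (by fun_prop) fun y => Or.inl ?_)
    positivity
  have hbw : Continuous (bilap w) := by
    have h2 : ContDiff ℝ 2 (lap w) := ContDiff.lap (k := 4) (m := 2) hw (by norm_num)
    exact (ContDiff.lap (k := 2) (m := 0) h2 (by norm_num)).continuous
  have hbF : ∀ e, 0 < e → Continuous (bilap (F e)) := fun e he => by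
    have h2 : ContDiff ℝ 2 (lap (F e)) :=
      ContDiff.lap (k := 4) (m := 2) (hFs e he) (by norm_num)
    exact (ContDiff.lap (k := 2) (m := 0) h2 (by norm_num)).continuous
  have T1 := tendsto_integral_cutProfile hn hbw hwc.lap.lap
  have T2 := (tendsto_integral_bubble hw.continuous hwc).const_mul c
  have T3 : Tendsto (fun e : ℝ => ∫ y, (bilap (F e) y - c * G e y) * w y)
      (nhdsWithin 0 (Set.Ioi 0))
      (nhds (∫ y, (if ‖y‖ ^ 2 < 1 / 2 then 0 else A₀ (‖y‖ ^ 2)) * w y)) := by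
    have hR : ∀ e, 0 < e → ∀ y, bilap (F e) y - c * G e y =
        if ‖y‖ ^ 2 + e ^ 2 < 1 / 2 then 0 else
          A₀ (‖y‖ ^ 2 + e ^ 2) + e ^ 2 * A₁ (‖y‖ ^ 2 + e ^ 2) +
            (e ^ 2) ^ 2 * A₂ (‖y‖ ^ 2 + e ^ 2) - c * G e y := fun e he y => by
      rw [hF, hb _ (by positivity) y]
      split_ifs
      · simp [hG]
      · rfl
    have hlt1 : ∀ᶠ e : ℝ in nhdsWithin 0 (Set.Ioi 0), e < 1 :=
      mem_nhdsWithin_of_mem_nhds (gt_mem_nhds one_pos)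
    refine tendsto_integral_filter_of_dominated_convergence
      (fun y => (3 * B + c * (1 / 2) ^ (-((n : ℝ) + 4) / 2)) * ‖w y‖) ?_ ?_ ?_ ?_
    · filter_upwards [self_mem_nhdsWithin] with e he
      exact (((hbF e he).sub (continuous_const.mul (hGc e he))).mul
        hw.continuous).aestronglyMeasurable
    · filter_upwards [self_mem_nhdsWithin, hlt1] with e he h1
      refine ae_of_all _ fun y => ?_
      have he0 : 0 < e := he
      have he1 : e ^ 2 ≤ 1 := pow_le_one₀ he0.le h1.le
      have he2 : (e ^ 2) ^ 2 ≤ 1 := pow_le_one₀ (by positivity) he1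
      rw [norm_mul, hR e he]
      refine mul_le_mul_of_nonneg_right ?_ (norm_nonneg _)
      split_ifs with ht
      · rw [norm_zero]; positivity
      · have a1 : |e ^ 2 * A₁ (‖y‖ ^ 2 + e ^ 2)| ≤ B := by
          rw [abs_mul, abs_of_nonneg (by positivity)]
          exact (mul_le_mul he1 (b1 _) (abs_nonneg _) zero_le_one).trans_eq (one_mul _)
        have a2 : |(e ^ 2) ^ 2 * A₂ (‖y‖ ^ 2 + e ^ 2)| ≤ B := by
          rw [abs_mul, abs_of_nonneg (by positivity)]
          exact (mul_le_mul he2 (b2 _) (abs_nonneg _) zero_le_one).trans_eq (one_mul _)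
        have a3 : G e y ≤ (1 / 2) ^ (-((n : ℝ) + 4) / 2) := by
          refine (mul_le_mul he2 (Real.rpow_le_rpow_of_nonpos (by norm_num) (not_lt.1 ht)
            (by linarith)) (by positivity) zero_le_one).trans_eq (one_mul _)
        have a4 : 0 ≤ G e y := by positivity
        have a5 := mul_le_mul_of_nonneg_left a3 hc0
        have a6 := mul_nonneg hc0 a4
        have a0 := b0 (‖y‖ ^ 2 + e ^ 2)
        rw [Real.norm_eq_abs]
        rw [abs_le] at a0 a1 a2 ⊢
        constructor <;> linarith [a0.1, a0.2, a1.1, a1.2, a2.1, a2.2]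
    · exact (hw.continuous.integrable_of_hasCompactSupport hwc).norm.const_mul _
    · refine ae_of_all _ fun y => Tendsto.mul_const _ ?_
      have ht : Tendsto (fun e : ℝ => ‖y‖ ^ 2 + e ^ 2) (nhdsWithin 0 (Set.Ioi 0))
          (nhds (‖y‖ ^ 2)) := by
        have h2 : Tendsto (fun e : ℝ => ‖y‖ ^ 2 + e ^ 2) (nhds 0) (nhds (‖y‖ ^ 2 + 0 ^ 2)) :=
          Continuous.tendsto (by fun_prop) 0
        rw [zero_pow two_ne_zero, add_zero] at h2
        exact h2.mono_left nhdsWithin_le_nhds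
      split_ifs with hy
      · refine tendsto_const_nhds.congr' ?_
        filter_upwards [self_mem_nhdsWithin, ht.eventually (gt_mem_nhds hy)] with e he h2
        rw [hR e he, if_pos h2]
      · have hy1 : 1 / 2 ≤ ‖y‖ ^ 2 := not_lt.1 hy
        have hpos : ‖y‖ ^ 2 + (0 : ℝ) ^ 2 ≠ 0 := by
          rw [zero_pow two_ne_zero, add_zero]; linarith
        have hcont : ContinuousAt (fun e : ℝ => A₀ (‖y‖ ^ 2 + e ^ 2) +
            e ^ 2 * A₁ (‖y‖ ^ 2 + e ^ 2) + (e ^ 2) ^ 2 * A₂ (‖y‖ ^ 2 + e ^ 2) - c * G e y) 0 := by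
          refine ContinuousAt.sub (Continuous.continuousAt (by fun_prop))
            (continuousAt_const.mul (ContinuousAt.mul (by fun_prop) ?_))
          exact ContinuousAt.rpow_const (by fun_prop) (Or.inl hpos)
        have := hcont.tendsto.mono_left (nhdsWithin_le_nhds (s := Set.Ioi 0))
        simp only [hG, zero_pow two_ne_zero, add_zero, zero_mul, mul_zero, sub_zero] at this
        refine this.congr' ?_
        filter_upwards [self_mem_nhdsWithin] with e he
        rw [hR e he, if_neg (by nlinarith [sq_nonneg e])]
  refine tendsto_nhds_unique T1 (Tendsto.congr' ?_ ((T2.add T3).trans_eq (by rw [mul_assoc c])))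
  filter_upwards [self_mem_nhdsWithin] with e he
  have i1 : Integrable fun y => bilap (F e) y * w y :=
    ((hbF e he).mul hw.continuous).integrable_of_hasCompactSupport hwc.mul_left
  have i2 : Integrable fun y => c * (G e y * w y) :=
    (((hGc e he).mul hw.continuous).integrable_of_hasCompactSupport hwc.mul_left).const_mul c
  rw [integral_mul_bilap_eq (hFs e he) hw (hFc e he), ← integral_const_mul,
    ← integral_add i2 ((i1.sub i2).congr (ae_of_all _ fun y => by simp only [Pi.sub_apply]; ring))]
  refine integral_congr_ae (ae_of_all _ fun y => ?_)
  simp only [hG]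
  ring

/-- Representation of a function on `ball 0 2` by its bilaplacian near the origin, through a
truncated fundamental solution `H` of `Δ²`. -/
theorem exists_truncated_fundamental_solution {n : ℕ} (hn : 5 ≤ n) :
    ∃ C B : ℝ, ∃ H k : EuclideanSpace ℝ (Fin n) → ℝ, 0 < C ∧ Measurable H ∧ Measurable k ∧
      (∀ y, 0 ≤ H y) ∧ (∀ y, H y ≤ ‖y‖ ^ (4 - n : ℝ)) ∧
      (∀ y, ‖y‖ < 1 / 2 → H y = ‖y‖ ^ (4 - n : ℝ)) ∧ (∀ y, 1 ≤ ‖y‖ → H y = 0) ∧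
      (∀ y, |k y| ≤ B) ∧ (∀ y, 1 ≤ ‖y‖ → k y = 0) ∧
      ∀ w : EuclideanSpace ℝ (Fin n) → ℝ, ContDiffOn ℝ 4 w (ball 0 2) →
        ∫ y, H y * bilap w y = C * w 0 + ∫ y, k y * w y := by
  obtain ⟨k, B, km, kB, k0, hk⟩ := integral_cutProfile_mul_bilap hn
  have hn' : (5 : ℝ) ≤ n := by exact_mod_cast hn
  have H0 : ∀ y : EuclideanSpace ℝ (Fin n), 1 ≤ ‖y‖ → cutProfile n (‖y‖ ^ 2) = 0 :=
    fun y hy => cutProfile_eq_zero (by nlinarith)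
  refine ⟨((n - 4 : ℝ) * (n - 2) * n * (n + 2)) *
    (∫ y : EuclideanSpace ℝ (Fin n), (1 + ‖y‖ ^ 2) ^ (-((n : ℝ) + 4) / 2)), B,
    fun y => cutProfile n (‖y‖ ^ 2), k, ?_, ?_, km, fun y => cutProfile_nonneg
    (by positivity), fun y => ?_, fun y hy => ?_, H0, kB, k0, fun w hw => ?_⟩
  rotate_left 4
  · let χ : ContDiffBump (0 : EuclideanSpace ℝ (Fin n)) := ⟨5 / 4, 3 / 2, by norm_num, by norm_num⟩
    have hs : HasCompactSupport fun y => χ y * w y := χ.hasCompactSupport.mul_right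
    have hd : ContDiff ℝ 4 fun y => χ y * w y := by
      refine contDiff_iff_contDiffAt.2 fun x => ?_
      by_cases hx : x ∈ tsupport fun y => χ y * w y
      swap
      · exact (contDiffAt_const (c := (0 : ℝ))).congr_of_eventuallyEq
          (notMem_tsupport_iff_eventuallyEq.1 hx)
      have hx2 : x ∈ ball (0 : EuclideanSpace ℝ (Fin n)) 2 := by
        have := tsupport_mul_subset_left hx
        rw [χ.tsupport_eq] at this
        exact closedBall_subset_ball (by norm_num [χ]) this
      exact χ.contDiffAt.mul (hw.contDiffAt (isOpen_ball.mem_nhds hx2))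
    have heq : ∀ y ∈ ball (0 : EuclideanSpace ℝ (Fin n)) (5 / 4), χ y * w y = w y := fun y hy => by
      rw [χ.one_of_mem_closedBall (ball_subset_closedBall hy), one_mul]
    have := hk _ hd hs
    rw [heq 0 (by simp)] at this
    convert this using 1
    · refine integral_congr_ae (ae_of_all _ fun y => ?_)
      simp only
      rcases lt_or_ge ‖y‖ 1 with h | h
      · congr 1
        refine bilap_congr_of_eventuallyEq ?_
        filter_upwards [isOpen_ball.mem_nhds (show y ∈ ball (0 : EuclideanSpace ℝ (Fin n)) (5 / 4)
          by simpa using h.trans (by norm_num))] with z hz using (heq z hz).symm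
      · rw [H0 y h]; simp
    · congr 1
      refine integral_congr_ae (ae_of_all _ fun y => ?_)
      simp only
      rcases lt_or_ge ‖y‖ 1 with h | h
      · rw [heq y (by simpa using h.trans (by norm_num))]
      · rw [k0 y h]; simp
  · have h1 : (0 : ℝ) < n - 4 := by linarith
    have h2 : (0 : ℝ) < n - 2 := by linarith
    refine mul_pos (by positivity) ?_
    refine (integral_pos_iff_support_of_nonneg (fun y => by positivity) (integrable_bubble n)).2 ?_
    rw [show Function.support (fun y : EuclideanSpace ℝ (Fin n) =>
      (1 + ‖y‖ ^ 2) ^ (-((n : ℝ) + 4) / 2)) = Set.univ from ?_]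
    · exact isOpen_univ.measure_pos _ ⟨0, trivial⟩
    · refine Set.eq_univ_of_forall fun y => ?_
      rw [Function.mem_support]
      positivity
  · unfold cutProfile
    have : Continuous fun y : EuclideanSpace ℝ (Fin n) =>
        Real.smoothTransition (3 - 4 * ‖y‖ ^ 2) :=
      Real.smoothTransition.continuous.comp (by fun_prop)
    exact ((measurable_norm.pow_const 2).pow_const _).mul this.measurable
  · rw [← norm_sq_rpow_half n (norm_nonneg y)]
    exact cutProfile_le (by positivity)
  · rw [← norm_sq_rpow_half n (norm_nonneg y)]
    exact cutProfile_eq (by nlinarith [norm_nonneg y])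

theorem tendsto_integral_norm_translate_sub {n : ℕ} {g : EuclideanSpace ℝ (Fin n) → ℝ}
    (hg : Integrable g) :
    Tendsto (fun h : EuclideanSpace ℝ (Fin n) => ∫ y, ‖g (h + y) - g y‖) (nhds 0) (nhds 0) := by
  have : Fact ((1 : ENNReal) ≠ ⊤) := ⟨ENNReal.one_ne_top⟩
  set F := (memLp_one_iff_integrable.2 hg).toLp g with hF
  have hc : Continuous fun h : EuclideanSpace ℝ (Fin n) => ‖(DomAddAct.mk h +ᵥ F) - F‖ := by
    have : Continuous fun h : EuclideanSpace ℝ (Fin n) => DomAddAct.mk h +ᵥ F :=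
      (DomAddAct.continuous_mk).vadd continuous_const
    fun_prop
  have h0 : Tendsto (fun h : EuclideanSpace ℝ (Fin n) => ‖(DomAddAct.mk h +ᵥ F) - F‖) (nhds 0)
      (nhds 0) := by
    have := hc.tendsto 0
    have z : ‖(DomAddAct.mk (0 : EuclideanSpace ℝ (Fin n)) +ᵥ F) - F‖ = 0 := by
      rw [norm_eq_zero, sub_eq_zero]
      exact zero_vadd _ F
    rwa [z] at this
  refine h0.congr fun h => ?_
  rw [hF, DomAddAct.mk_vadd_toLp, ← MemLp.toLp_sub, L1.norm_eq_integral_norm]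
  refine integral_congr_ae ?_
  filter_upwards [MemLp.coeFn_toLp (((memLp_one_iff_integrable.2 hg).comp_measurePreserving
    (measurePreserving_vadd h volume)).sub (memLp_one_iff_integrable.2 hg))] with y hy
  exact congrArg norm hy

theorem abs_integral_translate_sub_le {n : ℕ} {g φ : EuclideanSpace ℝ (Fin n) → ℝ} {A : ℝ}
    (hg : Integrable g) (hφ : Measurable φ) (hA : ∀ y, |φ y| ≤ A)
    (x x' : EuclideanSpace ℝ (Fin n)) :
    |(∫ y, g y * φ (x + y)) - ∫ y, g y * φ (x' + y)| ≤
      A * ∫ y, ‖g ((x - x') + y) - g y‖ := by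
  have hA0 : 0 ≤ A := (abs_nonneg _).trans (hA 0)
  have e1 : ∫ y, g y * φ (x' + y) = ∫ y, g ((x - x') + y) * φ (x + y) := by
    rw [← integral_add_left_eq_self (fun y => g y * φ (x' + y)) (x - x')]
    refine integral_congr_ae (ae_of_all _ fun y => ?_)
    simp only
    congr 2
    abel
  have i0 : Integrable fun y => g ((x - x') + y) := hg.comp_add_left _
  have hφ' : AEStronglyMeasurable (fun y => φ (x + y)) volume :=
    (hφ.comp (measurable_const_add x)).aestronglyMeasurable
  have hb : ∀ᵐ y : EuclideanSpace ℝ (Fin n), ‖φ (x + y)‖ ≤ A := ae_of_all _ fun y => hA _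
  rw [e1, ← integral_sub (hg.mul_bdd hφ' hb) (i0.mul_bdd hφ' hb), ← integral_const_mul,
    ← Real.norm_eq_abs]
  refine norm_integral_le_of_norm_le ((i0.sub hg).norm.const_mul A) (ae_of_all _ fun y => ?_)
  rw [← sub_mul, norm_mul, mul_comm, norm_sub_rev]
  exact mul_le_mul_of_nonneg_right (hA _) (norm_nonneg _)

/-- Asymptotic solutions of an integral equation with integrable kernels subconverge to a
continuous solution. -/
theorem exists_continuous_limit_solution {n : ℕ} {H k : EuclideanSpace ℝ (Fin n) → ℝ} {C M p : ℝ}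
    (hH : Integrable H) (hk : Integrable k) (hC : 0 < C) (hp : 0 < p)
    (f : ℕ → EuclideanSpace ℝ (Fin n) → ℝ) (hm : ∀ j, Measurable (f j))
    (hb0 : ∀ j x, 0 ≤ f j x) (hbM : ∀ j x, f j x ≤ M) (hf0 : ∀ j, f j 0 = 1)
    (hf : ∀ x, ∀ ρ : ℝ, 0 < ρ → ∀ᶠ j in atTop,
      C * f j x = ρ ^ 4 * (∫ y, H y * f j (x + ρ • y) ^ p) - ∫ y, k y * f j (x + ρ • y)) :
    ∃ g : EuclideanSpace ℝ (Fin n) → ℝ, Continuous g ∧ (∀ x, 0 ≤ g x) ∧ (∀ x, g x ≤ M) ∧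
      g 0 = 1 ∧ ∀ x, ∀ ρ : ℝ, 0 < ρ →
        C * g x = ρ ^ 4 * (∫ y, H y * g (x + ρ • y) ^ p) - ∫ y, k y * g (x + ρ • y) := by
  have hM0 : 0 ≤ M := (hb0 0 0).trans (hbM 0 0)
  set ω : EuclideanSpace ℝ (Fin n) → ℝ := fun h =>
    C⁻¹ * (M ^ p * (∫ y, ‖H (h + y) - H y‖) + M * ∫ y, ‖k (h + y) - k y‖) with hω
  have ω0 : Tendsto ω (nhds 0) (nhds 0) := by
    have := (((tendsto_integral_norm_translate_sub hH).const_mul (M ^ p)).add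
      ((tendsto_integral_norm_translate_sub hk).const_mul M)).const_mul C⁻¹
    simpa only [mul_zero, add_zero] using this
  have hpm : ∀ j x, |f j x ^ p| ≤ M ^ p := fun j x => by
    rw [abs_of_nonneg (Real.rpow_nonneg (hb0 j x) p)]
    exact Real.rpow_le_rpow (hb0 j x) (hbM j x) hp.le
  have hab : ∀ j x, |f j x| ≤ M := fun j x => by rw [abs_of_nonneg (hb0 j x)]; exact hbM j x
  have hmod : ∀ x x', ∀ᶠ j in atTop, |f j x - f j x'| ≤ ω (x - x') := by
    intro x x'
    filter_upwards [hf x 1 one_pos, hf x' 1 one_pos] with j h1 h2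
    simp only [one_pow, one_mul, one_smul] at h1 h2
    have a1 := abs_integral_translate_sub_le hH ((hm j).pow_const p) (hpm j) x x'
    have a2 := abs_integral_translate_sub_le hk (hm j) (hab j) x x'
    have e : C * |f j x - f j x'| = |C * f j x - C * f j x'| := by
      rw [← mul_sub, abs_mul, abs_of_pos hC]
    rw [hω, le_inv_mul_iff₀ hC, e, h1, h2]
    rw [abs_le] at a1 a2 ⊢
    constructor <;> linarith [a1.1, a1.2, a2.1, a2.2]
  let d : ℕ → EuclideanSpace ℝ (Fin n) := TopologicalSpace.denseSeq _
  have hd : DenseRange d := TopologicalSpace.denseRange_denseSeq _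
  obtain ⟨a, -, φ, hφ, ha⟩ := (isCompact_univ_pi fun _ : ℕ =>
    isCompact_Icc (a := (0 : ℝ)) (b := M)).isSeqCompact (x := fun j i => f j (d i))
    fun j i _ => ⟨hb0 j _, hbM j _⟩
  have hda : ∀ i, CauchySeq fun j => f (φ j) (d i) := fun i =>
    (((continuous_apply i).tendsto a).comp ha).cauchySeq
  have hcau : ∀ x, CauchySeq fun j => f (φ j) x := by
    intro x
    rw [Metric.cauchySeq_iff']
    intro ε hε
    obtain ⟨i, hi⟩ : ∃ i, ω (x - d i) < ε / 4 := by
      have h1 : ∀ᶠ z in nhds x, ω (x - z) < ε / 4 := by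
        have : Tendsto (fun z => x - z) (nhds x) (nhds 0) := by
          have h3 : Continuous fun z : EuclideanSpace ℝ (Fin n) => x - z := by fun_prop
          simpa using h3.tendsto x
        exact (ω0.comp this).eventually (gt_mem_nhds (by positivity))
      obtain ⟨z, hz, i, rfl⟩ := mem_closure_iff_nhds.1 (hd x) _ h1
      exact ⟨i, hz⟩
    obtain ⟨N1, hN1⟩ := eventually_atTop.1 (hφ.tendsto_atTop.eventually (hmod x (d i)))
    obtain ⟨N2, hN2⟩ := Metric.cauchySeq_iff'.1 (hda i) (ε / 8) (by positivity)
    refine ⟨max N1 N2, fun j hj => ?_⟩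
    have b1 := hN1 j ((le_max_left _ _).trans hj)
    have b2 := hN1 (max N1 N2) (le_max_left _ _)
    have b3 := hN2 j ((le_max_right _ _).trans hj)
    have b4 := hN2 (max N1 N2) (le_max_right _ _)
    rw [Real.dist_eq] at b3 b4 ⊢
    rw [abs_lt] at b3 b4 ⊢
    rw [abs_le] at b1 b2
    constructor <;> linarith [b1.1, b1.2, b2.1, b2.2, b3.1, b3.2, b4.1, b4.2]
  choose g hg using fun x => cauchySeq_tendsto_of_complete (hcau x)
  have hg0 : ∀ x, 0 ≤ g x := fun x => ge_of_tendsto' (hg x) fun j => hb0 _ _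
  have hgM : ∀ x, g x ≤ M := fun x => le_of_tendsto' (hg x) fun j => hbM _ _
  have hgω : ∀ x x', |g x - g x'| ≤ ω (x - x') := fun x x' =>
    le_of_tendsto ((hg x).sub (hg x')).abs (hφ.tendsto_atTop.eventually (hmod x x'))
  refine ⟨g, ?_, hg0, hgM, ?_, fun x ρ hρ => ?_⟩
  · refine continuous_iff_continuousAt.2 fun x => ?_
    rw [ContinuousAt, tendsto_iff_dist_tendsto_zero]
    refine squeeze_zero (fun z => dist_nonneg) (fun z => hgω z x) (ω0.comp ?_)
    have h3 : Continuous fun z : EuclideanSpace ℝ (Fin n) => z - x := by fun_prop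
    simpa using h3.tendsto x
  · exact tendsto_nhds_unique (hg 0) (by simp [hf0])
  · have mm : ∀ j, Measurable fun y => f (φ j) (x + ρ • y) := fun j =>
      (hm _).comp (by fun_prop)
    have L1 : Tendsto (fun j => ∫ y, H y * f (φ j) (x + ρ • y) ^ p) atTop
        (nhds (∫ y, H y * g (x + ρ • y) ^ p)) := by
      refine tendsto_integral_of_dominated_convergence (fun y => M ^ p * ‖H y‖) (fun j => ?_)
        (hH.norm.const_mul _) (fun j => ae_of_all _ fun y => ?_) (ae_of_all _ fun y => ?_)
      · exact hH.aestronglyMeasurable.mul ((mm j).pow_const p).aestronglyMeasurable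
      · rw [norm_mul, mul_comm]
        exact mul_le_mul_of_nonneg_right (hpm _ _) (norm_nonneg _)
      · exact ((hg _).rpow_const (Or.inr hp.le)).const_mul _
    have L2 : Tendsto (fun j => ∫ y, k y * f (φ j) (x + ρ • y)) atTop
        (nhds (∫ y, k y * g (x + ρ • y))) := by
      refine tendsto_integral_of_dominated_convergence (fun y => M * ‖k y‖) (fun j => ?_)
        (hk.norm.const_mul _) (fun j => ae_of_all _ fun y => ?_) (ae_of_all _ fun y => ?_)
      · exact hk.aestronglyMeasurable.mul (mm j).aestronglyMeasurable
      · rw [norm_mul, mul_comm]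
        exact mul_le_mul_of_nonneg_right (hab _ _) (norm_nonneg _)
      · exact (hg _).const_mul _
    exact tendsto_nhds_unique_of_eventuallyEq ((hg x).const_mul C) ((L1.const_mul _).sub L2)
      (hφ.tendsto_atTop.eventually (hf x ρ hρ))

theorem integral_smul_kernel {n : ℕ} (g φ : EuclideanSpace ℝ (Fin n) → ℝ)
    (x : EuclideanSpace ℝ (Fin n)) {ρ : ℝ} (hρ : 0 < ρ) :
    ρ ^ 4 * ∫ y, g y * φ (x + ρ • y) =
      ∫ z, (ρ ^ (4 - n : ℝ) * g (ρ⁻¹ • z)) * φ (x + z) := by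
  have := Measure.integral_comp_smul (volume : Measure (EuclideanSpace ℝ (Fin n)))
    (fun z => g (ρ⁻¹ • z) * φ (x + z)) ρ
  simp only [smul_smul, inv_mul_cancel₀ hρ.ne', one_smul, finrank_euclideanSpace,
    Fintype.card_fin] at this
  rw [this, abs_of_pos (by positivity), smul_eq_mul, ← mul_assoc]
  simp only [mul_assoc]
  rw [integral_const_mul, ← mul_assoc]
  congr 1
  rw [Real.rpow_sub hρ, Real.rpow_natCast, div_eq_mul_inv]
  norm_cast

/-- A bounded solution of the truncated equation at every scale solves the equation with the
full Riesz kernel. -/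
theorem integral_equation_of_truncated {n : ℕ} (hn : 5 ≤ n)
    {H k f : EuclideanSpace ℝ (Fin n) → ℝ} {C B M p : ℝ} (hp : 1 < p)
    (hHm : Measurable H) (hH0 : ∀ y, 0 ≤ H y) (hHle : ∀ y, H y ≤ ‖y‖ ^ (4 - n : ℝ))
    (hHeq : ∀ y, ‖y‖ < 1 / 2 → H y = ‖y‖ ^ (4 - n : ℝ))
    (hHz : ∀ y, 1 ≤ ‖y‖ → H y = 0) (hkB : ∀ y, |k y| ≤ B) (hk0 : ∀ y, 1 ≤ ‖y‖ → k y = 0)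
    (hfc : Continuous f) (hf0 : ∀ x, 0 ≤ f x) (hfM : ∀ x, f x ≤ M)
    (hf : ∀ x, ∀ ρ : ℝ, 0 < ρ →
      C * f x = ρ ^ 4 * (∫ y, H y * f (x + ρ • y) ^ p) - ∫ y, k y * f (x + ρ • y))
    (x : EuclideanSpace ℝ (Fin n)) :
    Integrable (fun z => ‖z‖ ^ (4 - n : ℝ) * f (x + z) ^ p) ∧
      C * f x = ∫ z, ‖z‖ ^ (4 - n : ℝ) * f (x + z) ^ p := by
  have hn' : (5 : ℝ) ≤ n := by exact_mod_cast hn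
  have hB0 : 0 ≤ B := (abs_nonneg _).trans (hkB 0)
  have hM0 : 0 ≤ M := (hf0 0).trans (hfM 0)
  have hp0 : 0 < p := by linarith
  set ψ : EuclideanSpace ℝ (Fin n) → ℝ := fun z => f (x + z) ^ p with hψ
  have ψc : Continuous ψ := (hfc.comp (by fun_prop)).rpow_const fun _ => Or.inr hp0.le
  have ψ0 : ∀ z, 0 ≤ ψ z := fun z => Real.rpow_nonneg (hf0 _) _
  have ψM : ∀ z, ψ z ≤ M ^ p := fun z => Real.rpow_le_rpow (hf0 _) (hfM _) hp0.le
  set V : ℝ := volume.real (ball (0 : EuclideanSpace ℝ (Fin n)) 1) with hV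
  have iB : ∀ φ : EuclideanSpace ℝ (Fin n) → ℝ, Continuous φ → IntegrableOn φ (ball 0 1) :=
    fun φ hφ => (hφ.continuousOn.integrableOn_compact (isCompact_closedBall 0 1)).mono_set
      ball_subset_closedBall
  have kbd : ∀ ρ : ℝ, |∫ y, k y * f (x + ρ • y)| ≤ B * ∫ y in ball 0 1, f (x + ρ • y) := by
    intro ρ
    rw [← integral_const_mul, ← integral_indicator measurableSet_ball, ← Real.norm_eq_abs]
    have i1 : IntegrableOn (fun y => B * f (x + ρ • y)) (ball 0 1) :=
      iB _ (continuous_const.mul (hfc.comp (by fun_prop)))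
    refine norm_integral_le_of_norm_le (i1.integrable_indicator measurableSet_ball)
      (ae_of_all _ fun y => ?_)
    by_cases hy : y ∈ ball (0 : EuclideanSpace ℝ (Fin n)) 1
    · rw [Set.indicator_of_mem hy, norm_mul, Real.norm_of_nonneg (hf0 _)]
      exact mul_le_mul_of_nonneg_right (hkB y) (hf0 _)
    · rw [Set.indicator_of_notMem hy, hk0 y (by simpa using hy), zero_mul, norm_zero]
  set G : ℝ → EuclideanSpace ℝ (Fin n) → ℝ := fun ρ z =>
    (ρ ^ (4 - n : ℝ) * H (ρ⁻¹ • z)) * ψ z with hG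
  have hscale : ∀ ρ : ℝ, 0 < ρ → ∀ z : EuclideanSpace ℝ (Fin n),
      ρ ^ (4 - n : ℝ) * ‖ρ⁻¹ • z‖ ^ (4 - n : ℝ) = ‖z‖ ^ (4 - n : ℝ) := fun ρ hρ z => by
    rw [← Real.mul_rpow hρ.le (norm_nonneg _), norm_smul, norm_inv, Real.norm_of_nonneg hρ.le,
      mul_inv_cancel_left₀ hρ.ne']
  have hG0 : ∀ ρ : ℝ, 0 < ρ → ∀ z, 0 ≤ G ρ z := fun ρ hρ z =>
    mul_nonneg (mul_nonneg (Real.rpow_nonneg hρ.le _) (hH0 _)) (ψ0 z)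
  have hGle : ∀ ρ : ℝ, 0 < ρ → ∀ z, G ρ z ≤ ‖z‖ ^ (4 - n : ℝ) * ψ z := fun ρ hρ z => by
    refine mul_le_mul_of_nonneg_right ?_ (ψ0 z)
    rw [← hscale ρ hρ z]
    exact mul_le_mul_of_nonneg_left (hHle _) (Real.rpow_nonneg hρ.le _)
  have hGeq : ∀ ρ : ℝ, 0 < ρ → ∀ z, ‖z‖ < ρ / 2 → G ρ z = ‖z‖ ^ (4 - n : ℝ) * ψ z :=
    fun ρ hρ z hz => by
      simp only [hG]
      rw [hHeq, hscale ρ hρ z]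
      rw [norm_smul, norm_inv, Real.norm_of_nonneg hρ.le, inv_mul_lt_iff₀ hρ]
      linarith
  have hGf : ∀ ρ : ℝ, 0 < ρ → C * f x = (∫ z, G ρ z) - ∫ y, k y * f (x + ρ • y) := fun ρ hρ => by
    rw [hf x ρ hρ, integral_smul_kernel H (fun z => f z ^ p) x hρ]
  have hPm : Measurable fun z : EuclideanSpace ℝ (Fin n) => ‖z‖ ^ (4 - n : ℝ) * ψ z :=
    (measurable_norm.pow_const _).mul ψc.measurable
  have hP0 : ∀ z, 0 ≤ ‖z‖ ^ (4 - n : ℝ) * ψ z := fun z =>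
    mul_nonneg (Real.rpow_nonneg (norm_nonneg _) _) (ψ0 z)
  have hPon : ∀ r, IntegrableOn (fun z => ‖z‖ ^ (4 - n : ℝ) * ψ z) (ball 0 r) := fun r =>
    (integrableOn_ball_rpow_norm hn r).mul_bdd (c := M ^ p) ψc.aestronglyMeasurable
      (ae_of_all _ fun z => by rw [Real.norm_of_nonneg (ψ0 z)]; exact ψM z)
  have hGm : ∀ ρ, Measurable (G ρ) := fun ρ =>
    ((hHm.comp (measurable_const_smul _)).const_mul _).mul ψc.measurable
  have hGi : ∀ ρ : ℝ, 0 < ρ → Integrable (G ρ) := fun ρ hρ => by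
    refine ((hPon ρ).integrable_indicator measurableSet_ball).mono'
      (hGm ρ).aestronglyMeasurable (ae_of_all _ fun z => ?_)
    rw [Real.norm_of_nonneg (hG0 ρ hρ z)]
    by_cases hz : z ∈ ball (0 : EuclideanSpace ℝ (Fin n)) ρ
    · rw [Set.indicator_of_mem hz]
      exact hGle ρ hρ z
    · rw [Set.indicator_of_notMem hz]
      simp only [hG]
      rw [hHz]
      · simp
      · rw [norm_smul, norm_inv, Real.norm_of_nonneg hρ.le, le_inv_mul_iff₀ hρ, mul_one]
        simpa using hz
  have hk1 : ∀ ρ : ℝ, |∫ y, k y * f (x + ρ • y)| ≤ B * (M * V) := fun ρ => by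
    refine (kbd ρ).trans (mul_le_mul_of_nonneg_left ?_ hB0)
    have := setIntegral_mono_on (iB (fun y => f (x + ρ • y)) (hfc.comp (by fun_prop)))
      (iB (fun _ => M) continuous_const) measurableSet_ball fun y _ => hfM (x + ρ • y)
    rwa [setIntegral_const, smul_eq_mul, mul_comm V] at this
  have hint : Integrable fun z => ‖z‖ ^ (4 - n : ℝ) * ψ z := by
    refine AECover.integrable_of_integral_bounded_of_nonneg_ae (l := atTop)
      (φ := fun r : ℝ => ball (0 : EuclideanSpace ℝ (Fin n)) r) (aecover_ball tendsto_id)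
      (C * f x + B * (M * V)) hPon (ae_of_all _ hP0) ?_
    filter_upwards [eventually_gt_atTop 0] with r hr
    have h2r : 0 < 2 * r := by positivity
    have e : ∫ z in ball 0 r, ‖z‖ ^ (4 - n : ℝ) * ψ z = ∫ z in ball 0 r, G (2 * r) z :=
      setIntegral_congr_fun measurableSet_ball fun z hz => by
        rw [hGeq _ h2r z]
        have : ‖z‖ < r := by simpa using hz
        linarith
    rw [e]
    refine (setIntegral_le_integral (hGi _ h2r) (ae_of_all _ (hG0 _ h2r))).trans ?_
    have h1 := hGf _ h2r
    have h2 := le_abs_self (∫ y, k y * f (x + (2 * r) • y))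
    linarith [hk1 (2 * r)]
  refine ⟨hint, ?_⟩
  set I := ∫ z, ‖z‖ ^ (4 - n : ℝ) * ψ z with hI
  have L1 : Tendsto (fun ρ => ∫ z, G ρ z) atTop (nhds I) := by
    refine tendsto_integral_filter_of_dominated_convergence _
      (Eventually.of_forall fun ρ => (hGm ρ).aestronglyMeasurable) ?_ hint
      (ae_of_all _ fun z => ?_)
    · filter_upwards [eventually_gt_atTop 0] with ρ hρ
      refine ae_of_all _ fun z => ?_
      rw [Real.norm_of_nonneg (hG0 ρ hρ z)]
      exact hGle ρ hρ z
    · refine tendsto_const_nhds.congr' ?_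
      filter_upwards [eventually_gt_atTop (2 * ‖z‖), eventually_gt_atTop 0] with ρ h1 h2
      rw [hGeq ρ h2 z (by linarith)]
  have L2 : Tendsto (fun ρ : ℝ => ∫ y, k y * f (x + ρ • y)) atTop (nhds 0) := by
    have hbd : ∀ ρ : ℝ, 0 < ρ → |∫ y, k y * f (x + ρ • y)| ≤
        B * (ρ ^ (-(2 / (p - 1))) * V + ρ ^ (-2 : ℝ) * I) := fun ρ hρ => by
      refine (kbd ρ).trans (mul_le_mul_of_nonneg_left ?_ hB0)
      set δ : ℝ := ρ ^ (-(2 / (p - 1))) with hδ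
      have hδ0 : 0 < δ := Real.rpow_pos_of_pos hρ _
      have hp1 : p - 1 ≠ 0 := by linarith
      have hδp : δ ^ (1 - p) = ρ ^ (2 : ℝ) := by
        rw [hδ, ← Real.rpow_mul hρ.le]
        congr 1
        field_simp
        ring
      have hpt : ∀ t : ℝ, 0 ≤ t → t ≤ δ + ρ ^ (2 : ℝ) * t ^ p := fun t ht => by
        rcases le_or_gt t δ with h | h
        · have : 0 ≤ ρ ^ (2 : ℝ) * t ^ p := by positivity
          linarith
        · have ht0 : 0 < t := hδ0.trans h
          have h1 : t ^ (1 - p) ≤ δ ^ (1 - p) :=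
            Real.rpow_le_rpow_of_nonpos hδ0 h.le (by linarith)
          have h2 : t = t ^ (1 - p) * t ^ p := by
            rw [← Real.rpow_add ht0]; simp
          rw [hδp] at h1
          have := mul_le_mul_of_nonneg_right h1 (Real.rpow_nonneg ht p)
          linarith
      have hresc : ∫ y, ‖y‖ ^ (4 - n : ℝ) * ψ (ρ • y) = ρ ^ (-4 : ℝ) * I := by
        have := integral_smul_kernel (fun y => ‖y‖ ^ (4 - n : ℝ)) (fun z => f z ^ p) x hρ
        simp only [hscale ρ hρ] at this
        rw [hI, ← this, ← mul_assoc, ← Real.rpow_natCast, ← Real.rpow_add hρ]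
        norm_num [hψ]
      have ires : Integrable fun y => ‖y‖ ^ (4 - n : ℝ) * ψ (ρ • y) := by
        have h1 := ((integrable_comp_smul_iff volume _ hρ.ne').2 hint).const_mul
          (ρ ^ (4 - n : ℝ))⁻¹
        refine h1.congr (ae_of_all _ fun y => ?_)
        simp only
        rw [norm_smul, Real.norm_of_nonneg hρ.le, Real.mul_rpow hρ.le (norm_nonneg _)]
        have : ρ ^ (4 - n : ℝ) ≠ 0 := (Real.rpow_pos_of_pos hρ _).ne'
        field_simp
      have hle1 : ∫ y in ball 0 1, ψ (ρ • y) ≤ ρ ^ (-4 : ℝ) * I := by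
        rw [← hresc]
        refine le_trans ?_ (setIntegral_le_integral ires (s := ball 0 1) (ae_of_all _ fun y =>
          mul_nonneg (Real.rpow_nonneg (norm_nonneg _) _) (ψ0 _)))
        have hy0 : ∀ᵐ y : EuclideanSpace ℝ (Fin n) ∂volume.restrict (ball 0 1),
            y ∈ ball (0 : EuclideanSpace ℝ (Fin n)) 1 ∧ y ≠ 0 := by
          have : Nontrivial (EuclideanSpace ℝ (Fin n)) :=
            Module.nontrivial_of_finrank_pos (R := ℝ) (by simp; omega)
          refine (ae_restrict_mem measurableSet_ball).and (ae_restrict_of_ae ?_)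
          simp [ae_iff]
        refine integral_mono_ae (iB _ (ψc.comp (continuous_const_smul ρ))) ires.integrableOn ?_
        filter_upwards [hy0] with y hy
        have h1 : 1 ≤ ‖y‖ ^ (4 - n : ℝ) :=
          Real.one_le_rpow_of_pos_of_le_one_of_nonpos (norm_pos_iff.2 hy.2)
            (by simpa using (mem_ball_zero_iff.1 hy.1).le) (by linarith)
        exact le_mul_of_one_le_left (ψ0 _) h1
      calc ∫ y in ball 0 1, f (x + ρ • y)
          ≤ ∫ y in ball 0 1, (δ + ρ ^ (2 : ℝ) * ψ (ρ • y)) :=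
            setIntegral_mono_on (iB _ (hfc.comp (by fun_prop)))
              (iB _ (continuous_const.add (continuous_const.mul
                (ψc.comp (continuous_const_smul ρ))))) measurableSet_ball
              fun y _ => hpt _ (hf0 _)
        _ = δ * V + ρ ^ (2 : ℝ) * ∫ y in ball 0 1, ψ (ρ • y) := by
            have i2 : IntegrableOn (fun y => ρ ^ (2 : ℝ) * ψ (ρ • y)) (ball 0 1) :=
              iB _ (continuous_const.mul (ψc.comp (continuous_const_smul ρ)))
            rw [integral_add (iB _ continuous_const) i2, setIntegral_const, smul_eq_mul,
              integral_const_mul, mul_comm]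
        _ ≤ δ * V + ρ ^ (2 : ℝ) * (ρ ^ (-4 : ℝ) * I) := by gcongr
        _ = δ * V + ρ ^ (-2 : ℝ) * I := by
            rw [← mul_assoc, ← Real.rpow_add hρ]; norm_num
    have T1 : Tendsto (fun ρ : ℝ => ρ ^ (-(2 / (p - 1)))) atTop (nhds 0) :=
      tendsto_rpow_neg_atTop (div_pos two_pos (by linarith))
    have T2 : Tendsto (fun ρ : ℝ => ρ ^ (-2 : ℝ)) atTop (nhds 0) :=
      tendsto_rpow_neg_atTop two_pos
    have T := ((T1.mul_const V).add (T2.mul_const I)).const_mul B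
    simp only [zero_mul, add_zero, mul_zero] at T
    refine squeeze_zero_norm' ?_ T
    filter_upwards [eventually_gt_atTop 0] with ρ hρ using hbd ρ hρ
  have L3 := L1.sub L2
  rw [sub_zero] at L3
  refine tendsto_nhds_unique (tendsto_const_nhds.congr' ?_) L3
  filter_upwards [eventually_gt_atTop 0] with ρ hρ using hGf ρ hρ

theorem abs_det_reflection {F : Type*} [NormedAddCommGroup F] [InnerProductSpace ℝ F]
    [FiniteDimensional ℝ F] (K : Submodule ℝ F) :
    |((K.reflection : F →L[ℝ] F)).det| = 1 := by
  have h : (K.reflection : F →L[ℝ] F).toLinearMap * (K.reflection : F →L[ℝ] F).toLinearMap = 1 := by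
    ext x
    simp
  have h2 := congrArg LinearMap.det h
  rw [map_mul, map_one] at h2
  exact (abs_eq zero_le_one).2 (mul_self_eq_one_iff.1 h2)

section Inversion

open EuclideanGeometry

variable {n : ℕ}

local notation "𝔼" => EuclideanSpace ℝ (Fin n)

theorem inversion_image_punctured_ball {r : ℝ} (hr : 0 < r) :
    inversion (0 : 𝔼) r '' (ball 0 r \ {0}) = (closedBall 0 r)ᶜ := by
  have key : ∀ x : 𝔼, x ≠ 0 → ‖inversion 0 r x‖ = r ^ 2 / ‖x‖ := fun x _ => by
    simpa using dist_inversion_center 0 x r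
  ext y
  constructor
  · rintro ⟨x, ⟨hx, hx0⟩, rfl⟩
    have h0 : x ≠ 0 := hx0
    have h1 : ‖x‖ < r := by simpa using hx
    have h2 : 0 < ‖x‖ := norm_pos_iff.2 h0
    simp only [Set.mem_compl_iff, mem_closedBall, dist_zero_right, not_le]
    rw [key x h0, lt_div_iff₀ h2]
    nlinarith
  · intro hy
    have h1 : r < ‖y‖ := by simpa using hy
    have h2 : 0 < ‖y‖ := hr.trans h1
    have h0 : y ≠ 0 := norm_pos_iff.1 h2
    refine ⟨inversion 0 r y, ⟨?_, ?_⟩, inversion_inversion 0 hr.ne' y⟩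
    · rw [mem_ball, dist_zero_right, key y h0, div_lt_iff₀ h2]
      nlinarith
    · simpa using ⟨h0, hr.ne'⟩

/-- Folding an integral over `ℝⁿ` onto a ball by inversion in its boundary sphere. -/
theorem integral_eq_integral_ball_add_inversion (hn : 1 ≤ n) {r : ℝ} (hr : 0 < r)
    {g : 𝔼 → ℝ} (hg : Integrable g) :
    IntegrableOn (fun z => (r / ‖z‖) ^ (2 * n) * g (inversion 0 r z)) (ball 0 r) ∧
      ∫ y, g y = (∫ z in ball 0 r, g z) +
        ∫ z in ball 0 r, (r / ‖z‖) ^ (2 * n) * g (inversion 0 r z) := by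
  have : Nontrivial 𝔼 := Module.nontrivial_of_finrank_pos (R := ℝ) (by simp; omega)
  have hs : MeasurableSet (ball (0 : 𝔼) r \ {0}) :=
    measurableSet_ball.diff (measurableSet_singleton 0)
  have hae : (ball (0 : 𝔼) r \ {0} : Set 𝔼) =ᵐ[volume] ball 0 r :=
    sdiff_null_ae_eq_self (measure_singleton 0)
  have hd : ∀ x ∈ ball (0 : 𝔼) r \ {0}, HasFDerivWithinAt (inversion 0 r)
      ((r / dist x 0) ^ 2 • ((Submodule.span ℝ {x - 0})ᗮ.reflection : 𝔼 →L[ℝ] 𝔼))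
      (ball (0 : 𝔼) r \ {0}) x := fun x hx =>
    (hasFDerivAt_inversion (R := r) (by simpa using hx.2)).hasFDerivWithinAt
  have hinj : Set.InjOn (inversion 0 r) (ball (0 : 𝔼) r \ {0}) :=
    (inversion_injective 0 hr.ne').injOn
  have hdet : ∀ x : 𝔼, |((r / dist x 0) ^ 2 •
      ((Submodule.span ℝ {x - 0})ᗮ.reflection : 𝔼 →L[ℝ] 𝔼)).det| = (r / ‖x‖) ^ (2 * n) := by
    intro x
    rw [ContinuousLinearMap.det, ContinuousLinearMap.toLinearMap_smul, LinearMap.det_smul, abs_mul]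
    have := abs_det_reflection (Submodule.span ℝ {x - 0})ᗮ
    rw [ContinuousLinearMap.det] at this
    rw [this, mul_one, finrank_euclideanSpace, Fintype.card_fin, dist_zero_right, ← pow_mul,
      abs_of_nonneg (by positivity)]
  have h1 := integral_image_eq_integral_abs_det_fderiv_smul volume hs hd hinj g
  have h2 := (integrableOn_image_iff_integrableOn_abs_det_fderiv_smul volume hs hd hinj g).1
    hg.integrableOn
  simp only [hdet, smul_eq_mul] at h1 h2
  rw [inversion_image_punctured_ball hr, setIntegral_congr_set hae] at h1
  refine ⟨h2.congr_set_ae hae.symm, ?_⟩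
  rw [← h1, ← integral_add_compl (measurableSet_closedBall (x := (0 : 𝔼)) (ε := r)) hg]
  congr 1
  refine setIntegral_congr_set (ae_eq_of_subset_of_measure_ge ball_subset_closedBall ?_
    measurableSet_ball.nullMeasurableSet measure_closedBall_lt_top.ne).symm
  rw [Measure.addHaar_closedBall_eq_addHaar_ball]

end Inversion

section MovingSpheres

open EuclideanGeometry

/-- Bounded continuous nonnegative solutions of the integral equation
`C u(x) = ∫ |x - y|^{4-n} u(y)^p dy`. -/
structure IsRieszSolution (n : ℕ) (C M p : ℝ) (u : EuclideanSpace ℝ (Fin n) → ℝ) : Prop where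
  continuous : Continuous u
  nonneg : ∀ x, 0 ≤ u x
  le : ∀ x, u x ≤ M
  integrable : ∀ x, Integrable fun y => dist x y ^ (4 - n : ℝ) * u y ^ p
  eq : ∀ x, C * u x = ∫ y, dist x y ^ (4 - n : ℝ) * u y ^ p

variable {n : ℕ} {C M p r : ℝ} {u : EuclideanSpace ℝ (Fin n) → ℝ}

local notation "𝔼" => EuclideanSpace ℝ (Fin n)

/-- The Kelvin transform of `u` in the sphere of radius `r` centred at the origin. -/
noncomputable def kelvin (r : ℝ) (u : 𝔼 → ℝ) (x : 𝔼) : ℝ :=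
  (‖x‖ / r) ^ (4 - n : ℝ) * u (inversion 0 r x)

theorem norm_inversion_zero (r : ℝ) (x : 𝔼) : ‖inversion 0 r x‖ = r ^ 2 / ‖x‖ := by
  simpa using dist_inversion_center 0 x r

theorem sq_norm_div_mul_dist_inversion (hr : 0 < r) {x : 𝔼} (hx : x ≠ 0) (z : 𝔼) :
    (‖x‖ / r * dist (inversion 0 r x) z) ^ 2 =
      dist x z ^ 2 + (r ^ 2 - ‖x‖ ^ 2) * (r ^ 2 - ‖z‖ ^ 2) / r ^ 2 := by
  have hx' : ‖x‖ ≠ 0 := norm_ne_zero_iff.2 hx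
  rw [mul_pow, dist_eq_norm, dist_eq_norm, norm_sub_sq_real, norm_sub_sq_real,
    norm_inversion_zero, inversion]
  simp only [vsub_eq_sub, sub_zero, vadd_eq_add, add_zero, dist_zero_right, inner_smul_left]
  simp only [conj_trivial]
  field_simp
  ring

theorem norm_div_mul_dist_inversion_comm (hr : 0 < r) {x z : 𝔼} (hx : x ≠ 0) (hz : z ≠ 0) :
    ‖z‖ / r * dist x (inversion 0 r z) = ‖x‖ / r * dist (inversion 0 r x) z := by
  rw [dist_comm x]
  refine (sq_eq_sq₀ (by positivity) (by positivity)).1 ?_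
  rw [sq_norm_div_mul_dist_inversion hr hx, sq_norm_div_mul_dist_inversion hr hz, dist_comm]
  ring

theorem norm_div_mul_dist_inversion_inversion (hr : 0 < r) {x z : 𝔼} (hx : x ≠ 0) (hz : z ≠ 0) :
    ‖x‖ / r * dist (inversion 0 r x) (inversion 0 r z) = r / ‖z‖ * dist x z := by
  have hx' : ‖x‖ ≠ 0 := norm_ne_zero_iff.2 hx
  have hz' : ‖z‖ ≠ 0 := norm_ne_zero_iff.2 hz
  rw [dist_inversion_inversion hx hz, dist_zero_right, dist_zero_right]
  field_simp

/-- The difference of the Riesz kernel and its reflection in the sphere of radius `r`. -/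
noncomputable def reflectedKernel (r : ℝ) (x z : 𝔼) : ℝ :=
  dist x z ^ (4 - n : ℝ) - (‖x‖ / r * dist (inversion 0 r x) z) ^ (4 - n : ℝ)

theorem reflectedKernel_le (hr : 0 < r) (x z : 𝔼) :
    reflectedKernel r x z ≤ dist x z ^ (4 - n : ℝ) :=
  sub_le_self _ (by positivity)

theorem reflectedKernel_pos (hn : 5 ≤ n) (hr : 0 < r) {x z : 𝔼} (hx : x ≠ 0) (hxr : ‖x‖ < r)
    (hzr : ‖z‖ < r) (hxz : z ≠ x) : 0 < reflectedKernel r x z := by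
  have hn' : (5 : ℝ) ≤ n := by exact_mod_cast hn
  have hd : 0 < dist x z := dist_pos.2 hxz.symm
  refine sub_pos.2 (Real.rpow_lt_rpow_of_neg hd ?_ (by linarith))
  refine lt_of_pow_lt_pow_left₀ 2 (by positivity) ?_
  rw [sq_norm_div_mul_dist_inversion hr hx]
  have h1 : 0 < r ^ 2 - ‖x‖ ^ 2 := by nlinarith [norm_nonneg x]
  have h2 : 0 < r ^ 2 - ‖z‖ ^ 2 := by nlinarith [norm_nonneg z]
  have : 0 < (r ^ 2 - ‖x‖ ^ 2) * (r ^ 2 - ‖z‖ ^ 2) / r ^ 2 := by positivity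
  linarith

theorem IsRieszSolution.sub_kelvin_eq (h : IsRieszSolution n C M p u) (hn : 5 ≤ n) (hr : 0 < r)
    {x : 𝔼} (hx : x ≠ 0) :
    IntegrableOn (fun z => reflectedKernel r x z *
        (u z ^ p - (r / ‖z‖) ^ (n + 4 : ℝ) * u (inversion 0 r z) ^ p)) (ball 0 r) ∧
      C * (u x - kelvin r u x) = ∫ z in ball 0 r, reflectedKernel r x z *
        (u z ^ p - (r / ‖z‖) ^ (n + 4 : ℝ) * u (inversion 0 r z) ^ p) := by
  have hx' : 0 < ‖x‖ := norm_pos_iff.2 hx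
  set κ : ℝ := (‖x‖ / r) ^ (4 - n : ℝ) with hκ
  set Q : 𝔼 → ℝ := fun z => (‖x‖ / r * dist (inversion 0 r x) z) ^ (4 - n : ℝ) with hQ
  set W : 𝔼 → ℝ := fun z => (r / ‖z‖) ^ (n + 4 : ℝ) * u (inversion 0 r z) ^ p with hW
  have hpow : ∀ z : 𝔼, z ≠ 0 →
      (r / ‖z‖) ^ (2 * n) * (r / ‖z‖) ^ (4 - n : ℝ) = (r / ‖z‖) ^ (n + 4 : ℝ) := by
    intro z hz
    have hz' : 0 < ‖z‖ := norm_pos_iff.2 hz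
    rw [← Real.rpow_natCast, ← Real.rpow_add (by positivity)]
    congr 1
    push_cast
    ring
  have e1 : ∀ z : 𝔼, (r / ‖z‖) ^ (2 * n) *
      (dist x (inversion 0 r z) ^ (4 - n : ℝ) * u (inversion 0 r z) ^ p) = Q z * W z := by
    intro z
    rcases eq_or_ne z 0 with rfl | hz
    · have : (n + 4 : ℝ) ≠ 0 := by positivity
      simp [hW, Real.zero_rpow this, show n ≠ 0 by omega]
    have hz' : 0 < ‖z‖ := norm_pos_iff.2 hz
    have : dist x (inversion 0 r z) ^ (4 - n : ℝ) = (r / ‖z‖) ^ (4 - n : ℝ) * Q z := by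
      rw [hQ]
      simp only
      rw [← norm_div_mul_dist_inversion_comm hr hx hz, ← Real.mul_rpow (by positivity)
        (by positivity)]
      congr 1
      field_simp
    rw [this, hW]
    simp only
    rw [← hpow z hz]
    ring
  have e2 : ∀ z : 𝔼, κ * dist (inversion 0 r x) z ^ (4 - n : ℝ) = Q z := fun z =>
    (Real.mul_rpow (by positivity) (by positivity)).symm
  have e3 : ∀ z : 𝔼, (r / ‖z‖) ^ (2 * n) * (κ * (dist (inversion 0 r x)
      (inversion 0 r z) ^ (4 - n : ℝ) * u (inversion 0 r z) ^ p)) =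
      dist x z ^ (4 - n : ℝ) * W z := by
    intro z
    rcases eq_or_ne z 0 with rfl | hz
    · have : (n + 4 : ℝ) ≠ 0 := by positivity
      simp [hW, Real.zero_rpow this, show n ≠ 0 by omega]
    have hz' : 0 < ‖z‖ := norm_pos_iff.2 hz
    rw [← mul_assoc κ, e2, hQ, hW]
    simp only
    rw [norm_div_mul_dist_inversion_inversion hr hx hz, Real.mul_rpow (by positivity)
      (by positivity), ← hpow z hz]
    ring
  obtain ⟨i1, j1⟩ := integral_eq_integral_ball_add_inversion (by omega) hr (h.integrable x)
  obtain ⟨i2, j2⟩ := integral_eq_integral_ball_add_inversion (by omega) hr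
    ((h.integrable (inversion 0 r x)).const_mul κ)
  have k1 := (h.integrable x).integrableOn (s := ball 0 r)
  have k2 := ((h.integrable (inversion 0 r x)).const_mul κ).integrableOn (s := ball 0 r)
  rw [integral_const_mul, ← h.eq] at j2
  rw [← h.eq] at j1
  simp only [e1] at i1 j1
  simp only [e3] at i2 j2
  simp only [← mul_assoc κ, e2] at k2 j2
  have e4 : (fun z => reflectedKernel r x z * (u z ^ p - W z)) = fun z =>
      (dist x z ^ (4 - n : ℝ) * u z ^ p + Q z * W z) -
        (Q z * u z ^ p + dist x z ^ (4 - n : ℝ) * W z) := by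
    funext z
    rw [reflectedKernel]
    ring
  rw [e4]
  refine ⟨(k1.add i1).sub (k2.add i2), ?_⟩
  refine Eq.trans ?_ (integral_sub (k1.add i1) (k2.add i2)).symm
  rw [integral_add' k1 i1, integral_add' k2 i2, ← j1, ← j2, kelvin]
  ring

theorem kelvin_rpow_lt (hn : 5 ≤ n) (hp2 : p < (n + 4) / (n - 4 : ℝ))
    (hu : ∀ x, 0 < u x) {z : 𝔼} (hz : z ≠ 0) (hzr : ‖z‖ < r) :
    kelvin r u z ^ p < (r / ‖z‖) ^ (n + 4 : ℝ) * u (inversion 0 r z) ^ p := by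
  have hn' : (5 : ℝ) ≤ n := by exact_mod_cast hn
  have hz' : 0 < ‖z‖ := norm_pos_iff.2 hz
  have hr : 0 < r := hz'.trans hzr
  rw [kelvin, Real.mul_rpow (by positivity) (hu _).le, ← Real.rpow_mul (by positivity)]
  refine mul_lt_mul_of_pos_right ?_ (Real.rpow_pos_of_pos (hu _) _)
  rw [← inv_div, Real.inv_rpow (by positivity), ← Real.rpow_neg (by positivity)]
  refine Real.rpow_lt_rpow_of_exponent_lt ((one_lt_div hz').2 hzr) ?_
  rw [lt_div_iff₀ (by linarith)] at hp2
  nlinarith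

theorem exists_setIntegral_dist_rpow_le (hn : 5 ≤ n) {ε : ℝ} (hε : 0 < ε) :
    ∃ η : ENNReal, 0 < η ∧ ∀ A : Set 𝔼, MeasurableSet A → volume A < η → ∀ x : 𝔼,
      IntegrableOn (fun y => dist x y ^ (4 - n : ℝ)) A ∧
        ∫ y in A, dist x y ^ (4 - n : ℝ) ≤ ε := by
  have hn' : (5 : ℝ) ≤ n := by exact_mod_cast hn
  set F : 𝔼 → ENNReal := (ball (0 : 𝔼) 1).indicator fun y => ENNReal.ofReal (‖y‖ ^ (4 - n : ℝ))
    with hF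
  have hFm : Measurable F :=
    ((measurable_norm.pow_const _).ennreal_ofReal).indicator measurableSet_ball
  have hFi : ∫⁻ y, F y ≠ ⊤ := by
    rw [hF, lintegral_indicator measurableSet_ball]
    exact ((integrableOn_ball_rpow_norm hn 1).lintegral_lt_top).ne
  have hε2 : ENNReal.ofReal (ε / 2) ≠ 0 := by simpa using hε
  obtain ⟨δ, hδ, hδF⟩ := exists_pos_setLIntegral_lt_of_measure_lt hFi hε2
  refine ⟨min δ (ENNReal.ofReal (ε / 2)), lt_min hδ (pos_iff_ne_zero.2 hε2), fun A hA hAη x => ?_⟩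
  have hm : Measurable fun y : 𝔼 => dist x y ^ (4 - n : ℝ) :=
    (measurable_const.dist measurable_id).pow_const _
  have hpw : ∀ y : 𝔼, ENNReal.ofReal (dist x y ^ (4 - n : ℝ)) ≤ F (y - x) + 1 := by
    intro y
    rw [dist_comm, dist_eq_norm]
    by_cases hy : y - x ∈ ball (0 : 𝔼) 1
    · rw [hF, Set.indicator_of_mem hy]
      exact le_self_add
    · refine le_add_left (ENNReal.ofReal_le_one.2 ?_)
      exact Real.rpow_le_one_of_one_le_of_nonpos (by simpa using hy) (by linarith)
  have hmp := measurePreserving_sub_right (volume : Measure 𝔼) x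
  have hA' : volume ((fun y => y + x) ⁻¹' A) = volume A := by simp
  have hl : ∫⁻ y in A, F (y - x) = ∫⁻ y in (fun y => y + x) ⁻¹' A, F y := by
    rw [← hmp.setLIntegral_comp_preimage ((measurable_add_const x) hA) hFm]
    simp [← Set.preimage_comp, Function.comp_def]
  have hle : ∫⁻ y in A, ENNReal.ofReal (dist x y ^ (4 - n : ℝ)) ≤ ENNReal.ofReal ε := by
    calc ∫⁻ y in A, ENNReal.ofReal (dist x y ^ (4 - n : ℝ))
        ≤ ∫⁻ y in A, (F (y - x) + 1) := lintegral_mono fun y => hpw y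
      _ = (∫⁻ y in A, F (y - x)) + volume A := by
        rw [lintegral_add_right _ measurable_const]
        simp
      _ ≤ ENNReal.ofReal (ε / 2) + ENNReal.ofReal (ε / 2) := by
        refine add_le_add ?_ (hAη.le.trans (min_le_right _ _))
        rw [hl]
        exact (hδF _ (hA'.trans_lt (hAη.trans_le (min_le_left _ _)))).le
      _ = ENNReal.ofReal ε := by
        rw [← ENNReal.ofReal_add (by positivity) (by positivity), add_halves]
  have h0 : ∀ y : 𝔼, 0 ≤ dist x y ^ (4 - n : ℝ) := fun y => by positivity
  refine ⟨⟨hm.aestronglyMeasurable, ?_⟩, ?_⟩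
  · rw [hasFiniteIntegral_iff_ofReal (Eventually.of_forall h0)]
    exact hle.trans_lt ENNReal.ofReal_lt_top
  · rw [integral_eq_lintegral_of_nonneg_ae (Eventually.of_forall h0) hm.aestronglyMeasurable]
    exact ENNReal.toReal_le_of_le_ofReal hε.le hle

theorem rpow_sub_rpow_le {a c : ℝ} (hp : 1 ≤ p) (ha : 0 ≤ a) (hc : 0 ≤ c) :
    a ^ p - c ^ p ≤ p * a ^ (p - 1) * (a - c) := by
  rcases ha.eq_or_lt with rfl | ha
  · rw [Real.zero_rpow (by linarith)]
    rcases hp.eq_or_lt with rfl | hp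
    · simp
    · rw [Real.zero_rpow (by linarith)]
      have := Real.rpow_nonneg hc p
      linarith
  have h := one_add_mul_self_le_rpow_one_add (s := c / a - 1)
    (by have : 0 ≤ c / a := by positivity
        linarith) hp
  have e : a ^ p = a ^ (p - 1) * a := by
    rw [Real.rpow_sub_one ha.ne', div_mul_cancel₀ _ ha.ne']
  have h2 : (1 + (c / a - 1)) ^ p * a ^ p = c ^ p := by
    rw [← Real.mul_rpow (by rw [add_sub_cancel]; positivity) ha.le]
    congr 1
    field_simp
    ring
  have h3 := mul_le_mul_of_nonneg_right h (Real.rpow_nonneg ha.le p)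
  rw [h2] at h3
  have h4 : (1 + p * (c / a - 1)) * a ^ p = a ^ p + p * a ^ (p - 1) * (c - a) := by
    rw [e]
    field_simp
  linarith

theorem IsRieszSolution.bound_nonneg (h : IsRieszSolution n C M p u) : 0 ≤ M :=
  (h.nonneg 0).trans (h.le 0)

theorem kelvin_nonneg (hu : ∀ x, 0 ≤ u x) (hr : 0 < r) (x : 𝔼) : 0 ≤ kelvin r u x :=
  mul_nonneg (by positivity) (hu _)

/-- Maximum principle in sets of small measure. -/
theorem IsRieszSolution.exists_narrow (h : IsRieszSolution n C M p u) (hn : 5 ≤ n) (hC : 0 < C)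
    (hp1 : 1 < p) (hp2 : p < (n + 4) / (n - 4 : ℝ)) (hu : ∀ x, 0 < u x) :
    ∃ η : ENNReal, 0 < η ∧ ∀ A : Set 𝔼, MeasurableSet A → volume A < η → ∀ r : ℝ, 0 < r →
      (∀ x, x ≠ 0 → ‖x‖ < r → x ∉ A → u x ≤ kelvin r u x) →
      ∀ x, x ≠ 0 → ‖x‖ < r → u x ≤ kelvin r u x := by
  have : Nontrivial 𝔼 := Module.nontrivial_of_finrank_pos (R := ℝ) (by simp; omega)
  have hM := h.bound_nonneg
  set L : ℝ := p * M ^ (p - 1) with hL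
  have hL0 : 0 ≤ L := by positivity
  obtain ⟨η, hη, hηA⟩ := exists_setIntegral_dist_rpow_le hn
    (show 0 < C / (2 * (L + 1)) by positivity)
  refine ⟨η, hη, fun A hA hAη r hr hout => ?_⟩
  have step : ∀ D : ℝ, 0 ≤ D → (∀ x, x ≠ 0 → ‖x‖ < r → u x - kelvin r u x ≤ D) →
      ∀ x, x ≠ 0 → ‖x‖ < r → u x - kelvin r u x ≤ D / 2 := by
    intro D hD hle x hx hxr
    obtain ⟨hi, he⟩ := h.sub_kelvin_eq hn hr hx
    obtain ⟨hAi, hAε⟩ := hηA A hA hAη x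
    have hAi' : Integrable (A.indicator fun y => dist x y ^ (4 - n : ℝ) * (L * D)) :=
      (integrable_indicator_iff hA).2 (hAi.mul_const _)
    have hI0 : ∀ y, 0 ≤ A.indicator (fun y => dist x y ^ (4 - n : ℝ) * (L * D)) y := fun y =>
      Set.indicator_nonneg (fun y _ => by positivity) y
    have hae : ∀ᵐ z ∂(volume.restrict (ball (0 : 𝔼) r)), reflectedKernel r x z *
        (u z ^ p - (r / ‖z‖) ^ (n + 4 : ℝ) * u (inversion 0 r z) ^ p) ≤
        A.indicator (fun y => dist x y ^ (4 - n : ℝ) * (L * D)) z := by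
      have hz0 : ∀ᵐ z ∂(volume.restrict (ball (0 : 𝔼) r)), z ≠ 0 :=
        ae_restrict_of_ae (compl_mem_ae_iff.2 (measure_singleton 0))
      have hzx : ∀ᵐ z ∂(volume.restrict (ball (0 : 𝔼) r)), z ≠ x :=
        ae_restrict_of_ae (compl_mem_ae_iff.2 (measure_singleton x))
      filter_upwards [ae_restrict_mem measurableSet_ball, hz0, hzx] with z hz hz0 hzx
      have hzr : ‖z‖ < r := by simpa using hz
      have hK := reflectedKernel_pos hn hr hx hxr hzr hzx
      have hW := kelvin_rpow_lt hn hp2 hu hz0 hzr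
      have hk0 := kelvin_nonneg h.nonneg hr z
      by_cases hc : u z ≤ kelvin r u z
      · refine le_trans ?_ (hI0 z)
        refine mul_nonpos_of_nonneg_of_nonpos hK.le ?_
        have := Real.rpow_le_rpow (h.nonneg z) hc (by linarith : 0 ≤ p)
        linarith
      · have hzA : z ∈ A := by
          by_contra hzA
          exact hc (hout z hz0 hzr hzA)
        rw [Set.indicator_of_mem hzA]
        have h1 := rpow_sub_rpow_le hp1.le (h.nonneg z) hk0
        have h2 : p * u z ^ (p - 1) * (u z - kelvin r u z) ≤ L * D := by
          refine mul_le_mul ?_ (hle z hz0 hzr) (by linarith [not_le.1 hc]) hL0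
          exact mul_le_mul_of_nonneg_left
            (Real.rpow_le_rpow (h.nonneg z) (h.le z) (by linarith)) (by linarith)
        calc _ ≤ reflectedKernel r x z * (L * D) :=
              mul_le_mul_of_nonneg_left (by linarith) hK.le
          _ ≤ _ := mul_le_mul_of_nonneg_right (reflectedKernel_le hr x z) (by positivity)
    have h3 : C * (u x - kelvin r u x) ≤ C / (2 * (L + 1)) * (L * D) := by
      rw [he]
      calc _ ≤ ∫ z in ball (0 : 𝔼) r, A.indicator (fun y => dist x y ^ (4 - n : ℝ) * (L * D)) z :=
            integral_mono_ae hi hAi'.integrableOn hae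
        _ ≤ ∫ z, A.indicator (fun y => dist x y ^ (4 - n : ℝ) * (L * D)) z :=
            setIntegral_le_integral hAi' (Eventually.of_forall hI0)
        _ = (∫ z in A, dist x z ^ (4 - n : ℝ)) * (L * D) := by
            rw [integral_indicator hA, integral_mul_const]
        _ ≤ _ := mul_le_mul_of_nonneg_right hAε (by positivity)
    have h4 : C / (2 * (L + 1)) * (L * D) ≤ C * (D / 2) := by
      rw [div_mul_eq_mul_div, div_le_iff₀ (by positivity)]
      have : 0 ≤ C * D := by positivity
      nlinarith
    exact le_of_mul_le_mul_left (h3.trans h4) hC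
  have iter : ∀ k : ℕ, ∀ x, x ≠ 0 → ‖x‖ < r → u x - kelvin r u x ≤ M * (1 / 2) ^ k := by
    intro k
    induction k with
    | zero =>
      intro x _ _
      have := kelvin_nonneg h.nonneg hr x
      linarith [h.le x]
    | succ k ih =>
      intro x hx hxr
      refine (step _ (by positivity) ih x hx hxr).trans_eq ?_
      rw [pow_succ]
      ring
  intro x hx hxr
  have ht : Tendsto (fun k : ℕ => M * (1 / 2 : ℝ) ^ k) atTop (nhds (M * 0)) :=
    (tendsto_pow_atTop_nhds_zero_of_lt_one (by norm_num) (by norm_num)).const_mul M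
  rw [mul_zero] at ht
  linarith [ge_of_tendsto' ht fun k => iter k x hx hxr]

theorem IsRieszSolution.pos (h : IsRieszSolution n C M p u) (hn : 5 ≤ n) (hC : 0 < C)
    {x₀ : 𝔼} (h0 : 0 < u x₀) (x : 𝔼) : 0 < u x := by
  have : Nontrivial 𝔼 := Module.nontrivial_of_finrank_pos (R := ℝ) (by simp; omega)
  refine pos_of_mul_pos_right (b := u x) ?_ hC.le
  rw [h.eq, integral_pos_iff_support_of_nonneg (fun y => mul_nonneg (by positivity)
    (Real.rpow_nonneg (h.nonneg y) _)) (h.integrable x)]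
  have hs : {y | 0 < u y} \ {x} ⊆ Function.support
      fun y => dist x y ^ (4 - n : ℝ) * u y ^ p := by
    rintro y ⟨hy, hyx⟩
    have : 0 < dist x y := dist_pos.2 (Ne.symm hyx)
    exact (mul_pos (Real.rpow_pos_of_pos this _) (Real.rpow_pos_of_pos hy _)).ne'
  refine lt_of_lt_of_le ?_ (measure_mono hs)
  rw [measure_sdiff_null (measure_singleton x)]
  exact (isOpen_lt continuous_const h.continuous).measure_pos volume ⟨x₀, h0⟩

theorem IsRieszSolution.lt_kelvin (h : IsRieszSolution n C M p u) (hn : 5 ≤ n) (hC : 0 < C)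
    (hp1 : 1 < p) (hp2 : p < (n + 4) / (n - 4 : ℝ)) (hu : ∀ x, 0 < u x) (hr : 0 < r)
    (hle : ∀ x, x ≠ 0 → ‖x‖ < r → u x ≤ kelvin r u x) {x : 𝔼} (hx : x ≠ 0) (hxr : ‖x‖ < r) :
    u x < kelvin r u x := by
  have : Nontrivial 𝔼 := Module.nontrivial_of_finrank_pos (R := ℝ) (by simp; omega)
  obtain ⟨hi, he⟩ := h.sub_kelvin_eq hn hr hx
  have hneg : ∀ z : 𝔼, z ∈ ball (0 : 𝔼) r \ {0, x} → reflectedKernel r x z *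
      (u z ^ p - (r / ‖z‖) ^ (n + 4 : ℝ) * u (inversion 0 r z) ^ p) < 0 := by
    rintro z ⟨hz, hzx⟩
    have hzr : ‖z‖ < r := by simpa using hz
    simp only [Set.mem_insert_iff, Set.mem_singleton_iff, not_or] at hzx
    refine mul_neg_of_pos_of_neg (reflectedKernel_pos hn hr hx hxr hzr hzx.2) ?_
    have := Real.rpow_le_rpow (h.nonneg z) (hle z hzx.1 hzr) (by linarith : 0 ≤ p)
    linarith [kelvin_rpow_lt hn hp2 hu hzx.1 hzr]
  have hnull : volume ({0, x} : Set 𝔼) = 0 := (Set.toFinite _).measure_zero _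
  have hpos : 0 < ∫ z in ball (0 : 𝔼) r, -(reflectedKernel r x z *
      (u z ^ p - (r / ‖z‖) ^ (n + 4 : ℝ) * u (inversion 0 r z) ^ p)) := by
    refine (setIntegral_pos_iff_support_of_nonneg_ae ?_ hi.neg).2 ?_
    · have hz0 : ∀ᵐ z ∂(volume.restrict (ball (0 : 𝔼) r)), z ∉ ({0, x} : Set 𝔼) :=
        ae_restrict_of_ae (compl_mem_ae_iff.2 hnull)
      filter_upwards [ae_restrict_mem measurableSet_ball, hz0] with z hz hz0
      exact (neg_pos.2 (hneg z ⟨hz, hz0⟩)).le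
    · refine lt_of_lt_of_le ?_ (measure_mono (s := ball (0 : 𝔼) r \ {0, x}) ?_)
      · rw [measure_sdiff_null hnull]
        exact measure_ball_pos _ _ hr
      · exact fun z hz => ⟨(neg_pos.2 (hneg z hz)).ne', hz.1⟩
  rw [integral_neg, ← he, neg_pos] at hpos
  have := neg_of_mul_neg_right hpos hC.le
  linarith

theorem continuousAt_kelvin (hu : Continuous u) (hr : 0 < r) {x : 𝔼} (hx : x ≠ 0) :
    ContinuousAt (fun q : ℝ × 𝔼 => kelvin q.1 u q.2) (r, x) := by
  have hx' : 0 < ‖x‖ := norm_pos_iff.2 hx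
  refine ContinuousAt.mul ?_ ?_
  · refine ContinuousAt.rpow_const ?_ (Or.inl (by positivity))
    exact continuous_snd.norm.continuousAt.div continuous_fst.continuousAt hr.ne'
  · refine hu.continuousAt.comp ?_
    exact ContinuousAt.inversion continuousAt_const continuousAt_fst continuousAt_snd hx

theorem exists_measure_ball_sdiff_lt (hn : 5 ≤ n) {η : ENNReal} (hη : 0 < η) (hr : 0 < r) :
    ∃ δ, 0 < δ ∧ δ < r ∧
      volume (ball (0 : 𝔼) (r + δ) \ (closedBall 0 (r - δ) \ ball 0 δ)) < η := by
  have : Nontrivial 𝔼 := Module.nontrivial_of_finrank_pos (R := ℝ) (by simp; omega)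
  set V : ENNReal := volume (ball (0 : 𝔼) 1)
  have hV : V ≠ ⊤ := measure_ball_lt_top.ne
  have hc : Continuous fun δ : ℝ =>
      (ENNReal.ofReal ((r + δ) ^ n - (r - δ) ^ n) + ENNReal.ofReal (δ ^ n)) * V := by
    refine ENNReal.continuous_mul_const hV |>.comp ?_
    exact (ENNReal.continuous_ofReal.comp (by fun_prop)).add
      (ENNReal.continuous_ofReal.comp (by fun_prop))
  have h0 : (ENNReal.ofReal ((r + 0) ^ n - (r - 0) ^ n) + ENNReal.ofReal ((0 : ℝ) ^ n)) * V < η := by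
    simpa [show n ≠ 0 by omega] using hη
  obtain ⟨δ, h3, h1, h2⟩ := (((hc.tendsto 0).eventually_lt_const h0).filter_mono
    nhdsWithin_le_nhds |>.and (Ioo_mem_nhdsGT hr) : ∀ᶠ δ in nhdsWithin (0 : ℝ) (Set.Ioi 0), _).exists
  refine ⟨δ, h1, h2, lt_of_le_of_lt ?_ h3⟩
  have hb : ∀ s : ℝ, 0 ≤ s → volume (ball (0 : 𝔼) s) = ENNReal.ofReal (s ^ n) * V := fun s hs => by
    rw [Measure.addHaar_ball _ _ hs, finrank_euclideanSpace, Fintype.card_fin]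
  calc _ ≤ volume ((ball (0 : 𝔼) (r + δ) \ ball 0 (r - δ)) ∪ ball 0 δ) := by
        refine measure_mono fun x hx => ?_
        by_cases hxδ : x ∈ ball (0 : 𝔼) δ
        · exact Or.inr hxδ
        · exact Or.inl ⟨hx.1, fun h => hx.2 ⟨ball_subset_closedBall h, hxδ⟩⟩
    _ ≤ volume (ball (0 : 𝔼) (r + δ) \ ball 0 (r - δ)) + volume (ball (0 : 𝔼) δ) :=
        measure_union_le _ _
    _ = _ := by
        rw [measure_sdiff (ball_subset_ball (by linarith)) measurableSet_ball.nullMeasurableSet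
          measure_ball_lt_top.ne, hb _ (by linarith), hb _ (by linarith), hb _ h1.le, add_mul,
          ENNReal.ofReal_sub _ (pow_nonneg (by linarith) n), ENNReal.sub_mul fun _ _ => hV]

theorem IsRieszSolution.le_kelvin (h : IsRieszSolution n C M p u) (hn : 5 ≤ n) (hC : 0 < C)
    (hp1 : 1 < p) (hp2 : p < (n + 4) / (n - 4 : ℝ)) (hu : ∀ x, 0 < u x) (hr : 0 < r) {x : 𝔼}
    (hx : x ≠ 0) (hxr : ‖x‖ < r) : u x ≤ kelvin r u x := by
  obtain ⟨η, hη, hηA⟩ := h.exists_narrow hn hC hp1 hp2 hu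
  set T : Set ℝ := {r | ∀ x, x ≠ 0 → ‖x‖ < r → u x ≤ kelvin r u x} with hT
  have hsmall : ∃ a, 0 < a ∧ a < r ∧ a ∈ T := by
    obtain ⟨a, ha, har, haη⟩ := exists_measure_ball_sdiff_lt hn hη hr
    have hm : MeasurableSet (ball (0 : 𝔼) (r + a) \ (closedBall 0 (r - a) \ ball 0 a)) :=
      measurableSet_ball.diff (measurableSet_closedBall.diff measurableSet_ball)
    refine ⟨a, ha, har, hηA _ hm haη a ha fun x _ hxa hxA => absurd ?_ hxA⟩
    have hxa' : x ∈ ball (0 : 𝔼) a := by simpa using hxa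
    exact ⟨ball_subset_ball (by linarith) hxa', fun hx => hx.2 hxa'⟩
  obtain ⟨a, ha, har, haT⟩ := hsmall
  have hclosed : IsClosed (T ∩ Set.Icc a r) := by
    have : T ∩ Set.Icc a r = ⋂ x : 𝔼, ⋂ _ : x ≠ 0,
        (Set.Icc a r ∩ Set.Iic ‖x‖) ∪ (Set.Icc a r ∩ {s | u x ≤ kelvin s u x}) := by
      ext s
      simp only [hT, Set.mem_inter_iff, Set.mem_ofPred_eq, Set.mem_iInter, Set.mem_union,
        Set.mem_Iic]
      constructor
      · rintro ⟨h1, h2⟩ x hx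
        rcases le_or_gt s ‖x‖ with h3 | h3
        · exact Or.inl ⟨h2, h3⟩
        · exact Or.inr ⟨h2, h1 x hx h3⟩
      · intro h1
        refine ⟨fun x hx hxs => ?_, ?_⟩
        · rcases h1 x hx with h2 | h2
          · exact absurd hxs (not_lt.2 h2.2)
          · exact h2.2
        · exact (h1 x hx).elim And.left And.left
    rw [this]
    refine isClosed_iInter fun x => isClosed_iInter fun hx => IsClosed.union ?_ ?_
    · exact isClosed_Icc.inter isClosed_Iic
    · have hc : ContinuousOn (fun s => kelvin s u x) (Set.Icc a r) := fun s hs =>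
        (ContinuousAt.comp (f := fun s : ℝ => (s, x)) (continuousAt_kelvin h.continuous
          (ha.trans_le hs.1) hx) (by fun_prop)).continuousWithinAt
      exact hc.preimage_isClosed_of_isClosed isClosed_Icc isClosed_Ici
  refine hclosed.Icc_subset_of_forall_mem_nhdsWithin haT ?_ ⟨har.le, le_rfl⟩ x hx hxr
  rintro s ⟨hsT, has, hsr⟩
  have hs : 0 < s := ha.trans_le has
  obtain ⟨δ, hδ, hδs, hδη⟩ := exists_measure_ball_sdiff_lt hn hη hs
  have hm : MeasurableSet (ball (0 : 𝔼) (s + δ) \ (closedBall 0 (s - δ) \ ball 0 δ)) :=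
    measurableSet_ball.diff (measurableSet_closedBall.diff measurableSet_ball)
  have hcpt : IsCompact (closedBall (0 : 𝔼) (s - δ) \ ball 0 δ) :=
    (isCompact_closedBall _ _).diff isOpen_ball
  have hev := hcpt.eventually_forall_of_forall_eventually (x₀ := s)
    (P := fun t x => u x < kelvin t u x) fun x hx => by
      have hx0 : x ≠ 0 := by
        rintro rfl
        exact hx.2 (mem_ball_self hδ)
      have hxs : ‖x‖ < s := by
        have := hx.1
        rw [mem_closedBall, dist_zero_right] at this
        linarith
      exact ContinuousAt.eventually_lt (h.continuous.comp continuous_snd).continuousAt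
        (continuousAt_kelvin h.continuous hs hx0) (h.lt_kelvin hn hC hp1 hp2 hu hs hsT hx0 hxs)
  filter_upwards [hev.filter_mono nhdsWithin_le_nhds, Ioo_mem_nhdsGT (by linarith : s < s + δ)]
    with t ht hts
  refine hηA _ hm hδη t (hs.trans hts.1) fun x hx0 hxt hxA => (ht x ?_).le
  by_contra hxK
  exact hxA ⟨by simpa using hxt.trans hts.2, hxK⟩

theorem IsRieszSolution.exists_lower_bound (h : IsRieszSolution n C M p u) (hn : 5 ≤ n)
    (hC : 0 < C) (hp1 : 1 < p) (hp2 : p < (n + 4) / (n - 4 : ℝ)) (hu : ∀ x, 0 < u x) :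
    ∃ m, 0 < m ∧ ∀ y, 1 ≤ ‖y‖ → m * ‖y‖ ^ (-((n - 4) / 2 : ℝ)) ≤ u y := by
  have : Nontrivial 𝔼 := Module.nontrivial_of_finrank_pos (R := ℝ) (by simp; omega)
  obtain ⟨x₀, -, hx₀⟩ := (isCompact_sphere (0 : 𝔼) 1).exists_isMinOn
    (NormedSpace.sphere_nonempty.2 zero_le_one) h.continuous.continuousOn
  refine ⟨u x₀, hu x₀, fun y hy => ?_⟩
  have hy0 : 0 < ‖y‖ := by linarith
  have hs : ‖(‖y‖⁻¹ • y)‖ = 1 := by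
    rw [norm_smul, norm_inv, norm_norm, inv_mul_cancel₀ hy0.ne']
  have hmin : u x₀ ≤ u (‖y‖⁻¹ • y) := hx₀ (by simpa using hs)
  rcases hy.eq_or_lt with hy1 | hy1
  · rw [← hy1] at hmin ⊢
    simpa using hmin
  have hk := h.le_kelvin hn hC hp1 hp2 hu (Real.sqrt_pos.2 hy0) (x := ‖y‖⁻¹ • y)
    (norm_ne_zero_iff.1 (by rw [hs]; exact one_ne_zero))
    (by rw [hs]; exact Real.lt_sqrt_of_sq_lt (by simpa using hy1))
  have hinv : inversion 0 (√‖y‖) (‖y‖⁻¹ • y) = y := by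
    rw [inversion]
    simp only [vsub_eq_sub, sub_zero, vadd_eq_add, add_zero, dist_zero_right, hs, div_one]
    rw [Real.sq_sqrt hy0.le, smul_smul, mul_inv_cancel₀ hy0.ne', one_smul]
  have hpow : (‖(‖y‖⁻¹ • y)‖ / √‖y‖) ^ (4 - n : ℝ) * ‖y‖ ^ (-((n - 4) / 2 : ℝ)) = 1 := by
    rw [hs, one_div, Real.sqrt_eq_rpow, ← Real.rpow_neg hy0.le, ← Real.rpow_mul hy0.le,
      ← Real.rpow_add hy0]
    ring_nf
    exact Real.rpow_zero _
  rw [kelvin, hinv] at hk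
  have h3 := mul_le_mul_of_nonneg_right (hmin.trans hk)
    (Real.rpow_nonneg hy0.le (-((n - 4) / 2 : ℝ)))
  calc _ ≤ _ := h3
    _ = (‖(‖y‖⁻¹ • y)‖ / √‖y‖) ^ (4 - n : ℝ) * ‖y‖ ^ (-((n - 4) / 2 : ℝ)) * u y := by ring
    _ = u y := by rw [hpow, one_mul]

theorem IsRieszSolution.improve_lower_bound (h : IsRieszSolution n C M p u) (hn : 5 ≤ n)
    (hC : 0 < C) (hp : 1 < p) {a c : ℝ} (hc : 0 < c)
    (hle : ∀ y, 1 ≤ ‖y‖ → c * ‖y‖ ^ (-a) ≤ u y) :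
    ∃ c', 0 < c' ∧ ∀ y, 1 ≤ ‖y‖ → c' * ‖y‖ ^ (-(p * a - 4)) ≤ u y := by
  have hn' : (5 : ℝ) ≤ n := by exact_mod_cast hn
  have : Nontrivial 𝔼 := Module.nontrivial_of_finrank_pos (R := ℝ) (by simp; omega)
  set V : ℝ := volume.real (ball (0 : 𝔼) 1)
  have hV : 0 < V := ENNReal.toReal_pos (measure_ball_pos _ _ one_pos).ne' measure_ball_lt_top.ne
  set d : ℝ := min 1 (3 ^ (-a)) with hd
  have hd0 : 0 < d := by positivity
  refine ⟨C⁻¹ * (2 ^ (4 - n : ℝ) * (c * d) ^ p * V), by positivity, fun x hx => ?_⟩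
  have hx0 : 0 < ‖x‖ := by linarith
  have hpt : ∀ y ∈ ball ((2 : ℝ) • x) ‖x‖,
      (2 * ‖x‖) ^ (4 - n : ℝ) * (c * d * ‖x‖ ^ (-a)) ^ p ≤ dist x y ^ (4 - n : ℝ) * u y ^ p := by
    intro y hy
    rw [mem_ball, dist_eq_norm] at hy
    have e : ‖(2 : ℝ) • x‖ = 2 * ‖x‖ := by rw [norm_smul]; norm_num
    have hy1 : ‖x‖ < ‖y‖ := by
      have := norm_sub_norm_le ((2 : ℝ) • x) y
      rw [norm_sub_rev] at this
      linarith
    have hy3 : ‖y‖ ≤ 3 * ‖x‖ := by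
      have := norm_sub_norm_le y ((2 : ℝ) • x)
      linarith
    have hd2 : dist x y ≤ 2 * ‖x‖ := by
      rw [dist_comm, dist_eq_norm]
      have := norm_add_le (y - (2 : ℝ) • x) x
      have e2 : y - (2 : ℝ) • x + x = y - x := by rw [two_smul]; abel
      rw [e2] at this
      linarith
    have hd1 : 0 < dist x y := dist_pos.2 fun hxy => hy1.ne (by rw [hxy])
    refine mul_le_mul (Real.rpow_le_rpow_of_nonpos hd1 hd2 (by linarith)) ?_ (by positivity)
      (by positivity)
    refine Real.rpow_le_rpow (by positivity) (le_trans ?_ (hle y (hx.trans hy1.le))) (by linarith)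
    rw [mul_assoc]
    refine mul_le_mul_of_nonneg_left ?_ hc.le
    rcases le_total 0 a with ha | ha
    · calc d * ‖x‖ ^ (-a) ≤ 3 ^ (-a) * ‖x‖ ^ (-a) :=
            mul_le_mul_of_nonneg_right (min_le_right _ _) (by positivity)
        _ = (3 * ‖x‖) ^ (-a) := (Real.mul_rpow (by norm_num) hx0.le).symm
        _ ≤ ‖y‖ ^ (-a) := Real.rpow_le_rpow_of_nonpos (hx0.trans hy1) hy3 (by linarith)
    · calc d * ‖x‖ ^ (-a) ≤ 1 * ‖x‖ ^ (-a) :=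
            mul_le_mul_of_nonneg_right (min_le_left _ _) (by positivity)
        _ ≤ ‖y‖ ^ (-a) := by
            rw [one_mul]
            exact Real.rpow_le_rpow hx0.le hy1.le (by linarith)
  have hvol : volume.real (ball ((2 : ℝ) • x) ‖x‖) = ‖x‖ ^ n * V := by
    rw [Measure.real, Measure.addHaar_ball _ _ hx0.le, finrank_euclideanSpace, Fintype.card_fin,
      ENNReal.toReal_mul, ENNReal.toReal_ofReal (by positivity)]
    rfl
  have hint : (2 * ‖x‖) ^ (4 - n : ℝ) * (c * d * ‖x‖ ^ (-a)) ^ p * (‖x‖ ^ n * V) ≤ C * u x := by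
    rw [h.eq, ← hvol]
    calc _ = ∫ _ in ball ((2 : ℝ) • x) ‖x‖,
          (2 * ‖x‖) ^ (4 - n : ℝ) * (c * d * ‖x‖ ^ (-a)) ^ p := by
            rw [setIntegral_const, smul_eq_mul, mul_comm]
      _ ≤ ∫ y in ball ((2 : ℝ) • x) ‖x‖, dist x y ^ (4 - n : ℝ) * u y ^ p :=
          setIntegral_mono_on (integrableOn_const measure_ball_lt_top.ne)
            (h.integrable x).integrableOn measurableSet_ball hpt
      _ ≤ _ := setIntegral_le_integral (h.integrable x) (Eventually.of_forall fun y =>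
          mul_nonneg (by positivity) (Real.rpow_nonneg (h.nonneg y) _))
  have e : (2 * ‖x‖) ^ (4 - n : ℝ) * (c * d * ‖x‖ ^ (-a)) ^ p * (‖x‖ ^ n * V) =
      (2 ^ (4 - n : ℝ) * (c * d) ^ p * V) * ‖x‖ ^ (-(p * a - 4)) := by
    have e2 : ‖x‖ ^ (-(p * a - 4)) = ‖x‖ ^ (4 - n : ℝ) * (‖x‖ ^ (-a)) ^ p * ‖x‖ ^ n := by
      rw [← Real.rpow_mul hx0.le, ← Real.rpow_natCast, ← Real.rpow_add hx0, ← Real.rpow_add hx0]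
      ring_nf
    rw [e2, Real.mul_rpow (by norm_num) hx0.le, Real.mul_rpow (by positivity) (by positivity)]
    ring
  rw [e] at hint
  rw [mul_assoc, inv_mul_le_iff₀ hC]
  exact hint

theorem IsRieszSolution.eq_zero (h : IsRieszSolution n C M p u) (hn : 5 ≤ n)
    (hC : 0 < C) (hp1 : 1 < p) (hp2 : p < (n + 4) / (n - 4 : ℝ)) (x : 𝔼) : u x = 0 := by
  by_contra hx
  have hn' : (5 : ℝ) ≤ n := by exact_mod_cast hn
  have : Nontrivial 𝔼 := Module.nontrivial_of_finrank_pos (R := ℝ) (by simp; omega)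
  have hu := h.pos hn hC ((h.nonneg x).lt_of_ne' hx)
  set α : ℝ := 4 / (p - 1) with hα
  set β : ℝ := α - (n - 4) / 2 with hβ
  have hp0 : 0 < p - 1 := by linarith
  have hβ0 : 0 < β := by
    rw [lt_div_iff₀ (by linarith)] at hp2
    rw [hβ, hα, sub_pos, lt_div_iff₀ hp0]
    nlinarith
  have hαp : p * α - 4 = α := by
    rw [hα]
    field_simp
    ring
  have iter : ∀ k : ℕ, ∃ c, 0 < c ∧ ∀ y, 1 ≤ ‖y‖ → c * ‖y‖ ^ (-(α - p ^ k * β)) ≤ u y := by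
    intro k
    induction k with
    | zero =>
      obtain ⟨m, hm, hmu⟩ := h.exists_lower_bound hn hC hp1 hp2 hu
      refine ⟨m, hm, fun y hy => ?_⟩
      have : α - p ^ 0 * β = (n - 4) / 2 := by
        rw [hβ]
        ring
      rw [this]
      exact hmu y hy
    | succ k ih =>
      obtain ⟨c, hc, hcu⟩ := ih
      obtain ⟨c', hc', hcu'⟩ := h.improve_lower_bound hn hC hp1 hc hcu
      refine ⟨c', hc', fun y hy => ?_⟩
      have : α - p ^ (k + 1) * β = p * (α - p ^ k * β) - 4 := by
        linear_combination -hαp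
      rw [this]
      exact hcu' y hy
  obtain ⟨k, hk⟩ := ((tendsto_pow_atTop_atTop_of_one_lt hp1).eventually_gt_atTop (α / β)).exists
  rw [div_lt_iff₀ hβ0] at hk
  obtain ⟨c, hc, hcu⟩ := iter k
  set γ : ℝ := -(α - p ^ k * β) with hγ
  have hγ0 : 0 < γ := by linarith
  obtain ⟨t, ht1, ht2⟩ := (((tendsto_rpow_atTop hγ0).const_mul_atTop hc).eventually_gt_atTop M
    |>.and (eventually_ge_atTop 1)).exists
  obtain ⟨y, hy⟩ := exists_norm_eq 𝔼 (zero_le_one.trans ht2)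
  have := hcu y (hy ▸ ht2)
  rw [hy] at this
  linarith [h.le y]

end MovingSpheres

theorem measurable_indicator_of_continuousOn {X : Type*} [TopologicalSpace X] [MeasurableSpace X]
    [OpensMeasurableSpace X] {s : Set X} (hs : MeasurableSet s) {f : X → ℝ}
    (hf : ContinuousOn f s) : Measurable (s.indicator f) := by
  classical
  rw [← Set.piecewise_eq_indicator]
  exact hf.measurable_piecewise continuousOn_const hs

theorem integrable_of_bounded_of_eq_zero {n : ℕ} {k : EuclideanSpace ℝ (Fin n) → ℝ} {B : ℝ}
    (hk : Measurable k) (hB : ∀ y, |k y| ≤ B) (h0 : ∀ y, 1 ≤ ‖y‖ → k y = 0) : Integrable k := by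
  have hi : IntegrableOn k (ball 0 1) :=
    Measure.integrableOn_of_bounded measure_ball_lt_top.ne hk.aestronglyMeasurable
      (Eventually.of_forall hB)
  refine (integrableOn_iff_integrable_of_support_subset fun y hy => ?_).1 hi
  by_contra h
  exact hy (h0 y (by simpa using h))

/-- Bounded normalized solutions on balls of large radius do not exist in the subcritical range. -/
theorem exists_radius_not_solution {n : ℕ} (hn : 5 ≤ n) {p : ℝ} (hp1 : 1 < p)
    (hp2 : p < (n + 4) / (n - 4 : ℝ)) (M : ℝ) :
    ∃ R : ℝ, 0 < R ∧ ∀ v : EuclideanSpace ℝ (Fin n) → ℝ, ContDiffOn ℝ 4 v (ball 0 R) →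
      (∀ x ∈ ball 0 R, 0 ≤ v x) → (∀ x ∈ ball 0 R, v x ≤ M) →
      (∀ x ∈ ball 0 R, bilap v x = v x ^ p) → v 0 ≠ 1 := by
  by_contra! hcon
  choose v hv hv0 hvM hveq hv1 using fun j : ℕ => hcon (j + 1) (by positivity)
  obtain ⟨C, B, H, k, hC, hHm, hkm, hH0, hHle, hHeq, hHz, hkB, hk0, hrep⟩ :=
    exists_truncated_fundamental_solution hn
  have hHi : Integrable H := by
    have hi : IntegrableOn H (ball 0 1) :=
      (integrableOn_ball_rpow_norm hn 1).mono' hHm.aestronglyMeasurable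
        (Eventually.of_forall fun y => by
          rw [Real.norm_of_nonneg (hH0 y)]
          exact hHle y)
    refine (integrableOn_iff_integrable_of_support_subset fun y hy => ?_).1 hi
    by_contra h
    exact hy (hHz y (by simpa using h))
  have hM : 0 ≤ M := zero_le_one.trans (hv1 0 ▸ hvM 0 0 (mem_ball_self (by positivity)))
  set f : ℕ → EuclideanSpace ℝ (Fin n) → ℝ := fun j => (ball 0 ((j : ℝ) + 1)).indicator (v j)
    with hf
  have hfv : ∀ (j : ℕ) x, x ∈ ball 0 ((j : ℝ) + 1) → f j x = v j x := fun j x hx =>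
    Set.indicator_of_mem hx _
  have hrepf : ∀ x, ∀ ρ : ℝ, 0 < ρ → ∀ᶠ j in atTop, C * f j x =
      ρ ^ 4 * (∫ y, H y * f j (x + ρ • y) ^ p) - ∫ y, k y * f j (x + ρ • y) := by
    intro x ρ hρ
    filter_upwards [tendsto_natCast_atTop_atTop.eventually_ge_atTop (‖x‖ + 2 * ρ)] with j hj
    have hmem : ∀ y ∈ ball (0 : EuclideanSpace ℝ (Fin n)) 2,
        x + ρ • y ∈ ball 0 ((j : ℝ) + 1) := by
      intro y hy
      rw [mem_ball, dist_zero_right] at hy ⊢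
      have h1 := norm_add_le x (ρ • y)
      rw [norm_smul, Real.norm_of_nonneg hρ.le] at h1
      nlinarith
    have h := hrep (fun y => v j (x + ρ • y)) ((hv j).comp (by fun_prop) hmem)
    have hb := bilap_comp_affine (v j) 1 ρ x
    simp only [one_mul] at hb
    have e1 : ∀ y, H y * bilap (fun y => v j (x + ρ • y)) y =
        ρ ^ 4 * (H y * f j (x + ρ • y) ^ p) := by
      intro y
      rcases le_or_gt 1 ‖y‖ with hy | hy
      · simp [hHz y hy]
      · have hy2 := hmem y (by rw [mem_ball, dist_zero_right]; linarith)
        rw [hb]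
        simp only
        rw [hveq j _ hy2, hfv j _ hy2]
        ring
    have e2 : ∀ y, k y * v j (x + ρ • y) = k y * f j (x + ρ • y) := by
      intro y
      rcases le_or_gt 1 ‖y‖ with hy | hy
      · simp [hk0 y hy]
      · rw [hfv j _ (hmem y (by rw [mem_ball, dist_zero_right]; linarith))]
    simp only [e1, e2, smul_zero, add_zero] at h
    rw [integral_const_mul, ← hfv j x (by simpa using hmem 0 (by simp))] at h
    linarith
  obtain ⟨g, hgc, hg0, hgM, hg1, hgeq⟩ := exists_continuous_limit_solution hHi
    (integrable_of_bounded_of_eq_zero hkm hkB hk0) hC (zero_lt_one.trans hp1) f (M := M)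
    (fun j => measurable_indicator_of_continuousOn measurableSet_ball (hv j).continuousOn)
    (fun j x => Set.indicator_nonneg (hv0 j) x)
    (fun j x => Set.indicator_apply_le' (hvM j x) fun _ => hM)
    (fun j => by rw [hfv j 0 (mem_ball_self (by positivity)), hv1 j]) hrepf
  have hint := integral_equation_of_truncated hn hp1 hHm hH0 hHle hHeq hHz hkB hk0 hgc hg0 hgM hgeq
  have e : ∀ x y : EuclideanSpace ℝ (Fin n), ‖y - x‖ ^ (4 - n : ℝ) * g (x + (y - x)) ^ p =
      dist x y ^ (4 - n : ℝ) * g y ^ p := fun x y => by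
    rw [add_sub_cancel, dist_comm, dist_eq_norm]
  have hsol : IsRieszSolution n C M p g :=
    { continuous := hgc
      nonneg := hg0
      le := hgM
      integrable := fun x => by simpa only [e] using (hint x).1.comp_sub_right x
      eq := fun x => by
        rw [(hint x).2, ← integral_sub_right_eq_self _ x]
        simp only [e] }
  exact one_ne_zero (hg1.symm.trans (hsol.eq_zero hn hC hp1 hp2 0))

/-- The rescaled solution at a point `z₀` where `c = 1 / u z₀`. -/
theorem bilap_rescale {n : ℕ} {p c : ℝ} (hc : 0 < c) (u : EuclideanSpace ℝ (Fin n) → ℝ)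
    (z₀ y : EuclideanSpace ℝ (Fin n)) (h0 : 0 ≤ u (z₀ + c ^ ((p - 1) / 4) • y))
    (h : bilap u (z₀ + c ^ ((p - 1) / 4) • y) = u (z₀ + c ^ ((p - 1) / 4) • y) ^ p) :
    bilap (fun y => c * u (z₀ + c ^ ((p - 1) / 4) • y)) y =
      (c * u (z₀ + c ^ ((p - 1) / 4) • y)) ^ p := by
  rw [bilap_comp_affine]
  simp only
  rw [h, Real.mul_rpow hc.le h0, ← Real.rpow_natCast, ← Real.rpow_mul hc.le]
  congr 1
  rw [show (p - 1) / 4 * ((4 : ℕ) : ℝ) = p - 1 by push_cast; ring, Real.rpow_sub_one hc.ne']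
  field_simp

theorem rpow_mul_le_of_solution_on_ball {n : ℕ} {p R d : ℝ} (hp1 : 1 < p) (hd : 0 < d)
    (hR0 : 0 < R)
    (hR : ∀ v : EuclideanSpace ℝ (Fin n) → ℝ, ContDiffOn ℝ 4 v (ball 0 R) →
      (∀ x ∈ ball 0 R, 0 ≤ v x) → (∀ x ∈ ball 0 R, v x ≤ 2 ^ (4 / (p - 1))) →
      (∀ x ∈ ball 0 R, bilap v x = v x ^ p) → v 0 ≠ 1)
    {u : EuclideanSpace ℝ (Fin n) → ℝ} {x : EuclideanSpace ℝ (Fin n)} {U : Set _}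
    (hU : closedBall x d ⊆ U)
    (hu : ContDiffOn ℝ 4 u U) (hu0 : ∀ z ∈ U, 0 ≤ u z) (hueq : ∀ z ∈ U, bilap u z = u z ^ p) :
    d ^ (4 / (p - 1)) * u x ≤ (2 * R) ^ (4 / (p - 1)) := by
  set α : ℝ := 4 / (p - 1) with hα
  have hp0 : 0 < p - 1 := by linarith
  have hα0 : 0 < α := by positivity
  have hxd : x ∈ closedBall x d := mem_closedBall_self hd.le
  obtain ⟨z₀, hz₀, hmax⟩ := (isCompact_closedBall x d).exists_isMaxOn ⟨x, hxd⟩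
    (f := fun z => (d - dist z x) ^ α * u z)
    (ContinuousOn.mul (ContinuousOn.rpow_const (by fun_prop) fun _ _ => Or.inr hα0.le)
      (hu.continuousOn.mono hU))
  have hmax' : ∀ z ∈ closedBall x d, (d - dist z x) ^ α * u z ≤ (d - dist z₀ x) ^ α * u z₀ :=
    fun z hz => hmax hz
  have hx := hmax' x hxd
  rw [dist_self, sub_zero] at hx
  by_contra! hlt
  have hpos : 0 < (d - dist z₀ x) ^ α * u z₀ := by
    have : 0 < (2 * R) ^ α := by positivity
    linarith
  set δ : ℝ := d - dist z₀ x with hδ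
  have hδ0 : 0 < δ := by
    refine (sub_nonneg.2 hz₀).lt_of_ne fun h => ?_
    rw [← hδ] at h
    rw [← h, Real.zero_rpow hα0.ne', zero_mul] at hpos
    exact hpos.false
  have hz0 : 0 < u z₀ := pos_of_mul_pos_right hpos (by positivity)
  set c : ℝ := (u z₀)⁻¹ with hc
  have hc0 : 0 < c := inv_pos.2 hz0
  set r : ℝ := c ^ ((p - 1) / 4) with hr
  have hr0 : 0 < r := by positivity
  have hrα : r ^ α = c := by
    rw [hr, ← Real.rpow_mul hc0.le, hα]
    field_simp
    exact Real.rpow_one c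
  have hrR : r * R < δ / 2 := by
    have h1 : (2 * R) ^ α < (δ / r) ^ α := by
      rw [Real.div_rpow hδ0.le hr0.le, hrα, hc, div_inv_eq_mul]
      exact hlt.trans_le hx
    have h2 := (Real.rpow_lt_rpow_iff (by positivity) (by positivity) hα0).1 h1
    rw [lt_div_iff₀ hr0] at h2
    linarith
  have hball : ∀ y ∈ ball (0 : EuclideanSpace ℝ (Fin n)) R, dist (z₀ + r • y) z₀ < δ / 2 := by
    intro y hy
    rw [mem_ball, dist_zero_right] at hy
    rw [dist_self_add_left, norm_smul, Real.norm_of_nonneg hr0.le]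
    nlinarith
  have hdist : ∀ y ∈ ball (0 : EuclideanSpace ℝ (Fin n)) R, δ / 2 ≤ d - dist (z₀ + r • y) x := by
    intro y hy
    have := dist_triangle (z₀ + r • y) z₀ x
    linarith [hball y hy]
  have hmem : ∀ y ∈ ball (0 : EuclideanSpace ℝ (Fin n)) R, z₀ + r • y ∈ closedBall x d := by
    intro y hy
    rw [mem_closedBall]
    linarith [hdist y hy]
  refine hR (fun y => c * u (z₀ + r • y)) ?_ ?_ ?_ ?_ ?_
  · exact contDiffOn_const.mul (hu.comp (by fun_prop) fun y hy => hU (hmem y hy))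
  · exact fun y hy => mul_nonneg hc0.le (hu0 _ (hU (hmem y hy)))
  · intro y hy
    have h1 : (δ / 2) ^ α * u (z₀ + r • y) ≤ δ ^ α * u z₀ :=
      (mul_le_mul_of_nonneg_right (Real.rpow_le_rpow (by positivity) (hdist y hy) hα0.le)
        (hu0 _ (hU (hmem y hy)))).trans (hmax' _ (hmem y hy))
    rw [Real.div_rpow hδ0.le (by norm_num), div_mul_eq_mul_div, div_le_iff₀ (by positivity)] at h1
    have h2 : 0 < δ ^ α := by positivity
    rw [hc, inv_mul_le_iff₀ hz0]
    refine le_of_mul_le_mul_left (h1.trans_eq ?_) h2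
    ring
  · exact fun y hy => bilap_rescale hc0 u z₀ y (hu0 _ (hU (hmem y hy))) (hueq _ (hU (hmem y hy)))
  · simp only [smul_zero, add_zero, hc]
    exact inv_mul_cancel₀ hz0.ne'

/-- Decay estimate: there is `C = C(n,p)` such that every nonnegative `C⁴`
solution of `Δ²u = u^p` in the exterior domain `{|x| > 1}` satisfies
`u(x) ≤ C |x|^{-4/(p-1)}` for `|x| > 2`. -/
theorem stmt_3 (n : ℕ) (hn : 5 ≤ n) (p : ℝ)
    (hp1 : 1 < p) (hp2 : p < ((n : ℝ) + 4) / ((n : ℝ) - 4)) :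
    ∃ C : ℝ, ∀ u : EuclideanSpace ℝ (Fin n) → ℝ,
      ContDiffOn ℝ 4 u {x : EuclideanSpace ℝ (Fin n) | 1 < ‖x‖} →
      (∀ x : EuclideanSpace ℝ (Fin n), 1 < ‖x‖ → 0 ≤ u x) →
      (∀ x : EuclideanSpace ℝ (Fin n), 1 < ‖x‖ → bilap u x = u x ^ p) →
      ∀ x : EuclideanSpace ℝ (Fin n), 2 < ‖x‖ →
        u x ≤ C * ‖x‖ ^ (-((4 : ℝ) / (p - 1))) := by
  obtain ⟨R, hR0, hR⟩ := exists_radius_not_solution hn hp1 hp2 (2 ^ (4 / (p - 1)))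
  refine ⟨(8 * R) ^ (4 / (p - 1)), fun u hu hu0 hueq x hx => ?_⟩
  have hx0 : 0 < ‖x‖ := by linarith
  have hsub : closedBall x (‖x‖ / 4) ⊆ {x : EuclideanSpace ℝ (Fin n) | 1 < ‖x‖} := by
    intro z hz
    rw [mem_closedBall, dist_comm, dist_eq_norm] at hz
    have := norm_sub_norm_le x z
    show 1 < ‖z‖
    linarith
  have h := rpow_mul_le_of_solution_on_ball hp1 (by positivity) hR0 hR hsub hu hu0 hueq
  rw [Real.rpow_neg hx0.le, ← div_eq_mul_inv, le_div_iff₀ (by positivity)]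
  have e1 : ‖x‖ ^ (4 / (p - 1)) = (4 : ℝ) ^ (4 / (p - 1)) * (‖x‖ / 4) ^ (4 / (p - 1)) := by
    rw [← Real.mul_rpow (by norm_num) (by positivity)]
    congr 1
    ring
  have e2 : (8 * R) ^ (4 / (p - 1)) = (4 : ℝ) ^ (4 / (p - 1)) * (2 * R) ^ (4 / (p - 1)) := by
    rw [← Real.mul_rpow (by norm_num) (by positivity)]
    congr 1
    ring
  rw [e1, e2, mul_left_comm, mul_comm (u x)]
  exact mul_le_mul_of_nonneg_left h (by positivity)
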